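/- arXiv:2407.11565 — 2 statements merged into one kernel-verified Lean document; each statement's English description precedes it below -/
import Mathlib

section
/- Let {g_i}_{i∈𝓘_N} be a normalized LF system on [0,1] with associated probability vectors 𝔭_0,…,𝔭_{N−1}. Suppose the 𝔭_i are not all equal, i.e., |{𝔭_i : i ∈ 𝓘_N}| ≥ 2. Then for every ε ∈ (0,1/2) there exists δ > 0 with the following property: for every compatible system {f_i}_{i∈𝓘_N} on [0,1] such that each f_i is Lipschitz with r_i := Lip(f_i) satisfying ε ≤ r_i ≤ 1−ε for all i ∈ 𝓘_N and Σ_{i∈𝓘_N} r_i < 1+δ, the unique continuous strictly increasing solution φ of g_i∘φ = φ∘f_i (i ∈ 𝓘_N) satisfies dim_H μ_φ < 1. -/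
open Set Filter Topology

/-- A normalized LF system (`d i = 1`): `g i x = (a i * x + b i)/(c i * x + 1)` with
`c i + 1 > 0`, `0 < a i − b i c i ≤ min 1 (c i + 1)²`, `b 0 = 0`,
`(a i + b i)/(c i + 1) = b (i+1)` for `i + 1 < N`, and
`(a (N-1) + b (N-1))/(c (N-1) + 1) = 1`. -/
def NormLFSystem (N : ℕ) (a b c : ℕ → ℝ) : Prop :=
  (∀ i < N, 0 < c i + 1) ∧
  (∀ i < N, 0 < a i - b i * c i ∧ a i - b i * c i ≤ min 1 ((c i + 1) ^ 2)) ∧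
  b 0 = 0 ∧
  (∀ i, i + 1 < N → (a i + b i) / (c i + 1) = b (i + 1)) ∧
  (a (N - 1) + b (N - 1)) / (c (N - 1) + 1) = 1

/-- `G i (y) = (a i − b i c i)(y+1) / ((b i y + 1)((a i + b i) y + (c i + 1)))`. -/
noncomputable def GLF (a b c : ℕ → ℝ) (i : ℕ) (y : ℝ) : ℝ :=
  (a i - b i * c i) * (y + 1) / ((b i * y + 1) * ((a i + b i) * y + (c i + 1)))

/-- `H i (y) = (a i y + c i) / (b i y + 1)`. -/
noncomputable def HLF (a b c : ℕ → ℝ) (i : ℕ) (y : ℝ) : ℝ :=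
  (a i * y + c i) / (b i * y + 1)

/-- The (finite) fixed point of `H i`: `c 0 / (1 − a 0)` for `i = 0`, and
`(a i − 1 + √((1 − a i)² + 4 b i c i)) / (2 b i)` for `i ≥ 1`. -/
noncomputable def fixPt (a b c : ℕ → ℝ) (i : ℕ) : ℝ :=
  if i = 0 then c 0 / (1 - a 0)
  else (a i - 1 + Real.sqrt ((1 - a i) ^ 2 + 4 * b i * c i)) / (2 * b i)

/-- `α := min{0, c 0/(1 − a 0) (omitted if a 0 = 1), fixPt i (1 ≤ i ≤ N−1)}`. -/
noncomputable def alphaLF (N : ℕ) (a b c : ℕ → ℝ) : ℝ :=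
  sInf ({0} ∪ (if a 0 = 1 then (∅ : Set ℝ) else {c 0 / (1 - a 0)}) ∪
    {x | ∃ i, 1 ≤ i ∧ i < N ∧ x = fixPt a b c i})

/-- The probability vector `𝔭 i = (G 0 (y_i), …, G (N−1) (y_i))`, where `y_i` is the
fixed point of `H i`, with the limit conventions at the degenerate fixed points:
`𝔭 0 := (1,0,…,0)` when the fixed point of `H 0` is `+∞` (i.e. `a 0 = 1`), and
`𝔭 i := (0,…,0,1)` when the fixed point is `−1` (the limit values of `G k`). -/
noncomputable def pVec (N : ℕ) (a b c : ℕ → ℝ) (i : ℕ) : ℕ → ℝ :=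
  if i = 0 ∧ a 0 = 1 then fun k => if k = 0 then 1 else 0
  else if fixPt a b c i = -1 then fun k => if k = N - 1 then 1 else 0
  else fun k => GLF a b c k (fixPt a b c i)

/-- A compatible system of `N` maps on `[0,1]`. -/
def CompatibleSystem (N : ℕ) (f : ℕ → ℝ → ℝ) : Prop :=
  (∀ i < N, Set.MapsTo (f i) (Set.Icc (0:ℝ) 1) (Set.Icc (0:ℝ) 1)) ∧
  (∀ i < N, ContinuousOn (f i) (Set.Icc (0:ℝ) 1)) ∧
  (∀ i < N, StrictMonoOn (f i) (Set.Icc (0:ℝ) 1)) ∧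
  f 0 0 = 0 ∧
  (∀ i, 1 ≤ i → i < N → f (i - 1) 1 = f i 0) ∧
  f (N - 1) 1 = 1

/-- `r` is the Lipschitz constant of `f` on `[0,1]`:
the least nonnegative constant `L` with `|f x − f y| ≤ L |x − y|` on `[0,1]`. -/
def IsLipConst (f : ℝ → ℝ) (r : ℝ) : Prop :=
  IsLeast {L : ℝ | 0 ≤ L ∧
    ∀ x ∈ Set.Icc (0:ℝ) 1, ∀ y ∈ Set.Icc (0:ℝ) 1, |f x - f y| ≤ L * |x - y|} r

open MeasureTheory in
/-- The (upper) Hausdorff dimension of a measure supported on `[0,1]`: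
`dim_H μ = inf {dim_H A : A ⊆ [0,1] Borel, μ(A) = 1}`. -/
noncomputable def dimHMeas (μ : Measure ℝ) : ENNReal :=
  sInf {v | ∃ A : Set ℝ, MeasurableSet A ∧ A ⊆ Set.Icc (0:ℝ) 1 ∧ μ A = 1 ∧ v = dimH A}


namespace LFSystem

variable {N : ℕ} {a b c : ℕ → ℝ}

lemma image_one_sub {k : ℕ} (h : NormLFSystem N a b c) (hk : k < N) :
    b k < (a k + b k) / (c k + 1) := by
  rw [lt_div_iff₀ (h.1 k hk)]
  nlinarith [(h.2.1 k hk).1]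

lemma b_nonneg (h : NormLFSystem N a b c) : ∀ k < N, 0 ≤ b k := by
  intro k
  induction k with
  | zero => intro _; rw [h.2.2.1]
  | succ k ih =>
    intro hk
    have h1 := image_one_sub h (k := k) (by omega)
    rw [h.2.2.2.1 k hk] at h1
    linarith [ih (by omega)]

lemma b_pos (h : NormLFSystem N a b c) {k : ℕ} (hk : k < N) (h0 : k ≠ 0) : 0 < b k := by
  obtain ⟨k, rfl⟩ := Nat.exists_eq_succ_of_ne_zero h0
  have h1 := image_one_sub h (k := k) (by omega)
  rw [h.2.2.2.1 k hk] at h1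
  linarith [b_nonneg h k (by omega)]

lemma image_one_le (hN : 2 ≤ N) (h : NormLFSystem N a b c) :
    ∀ k < N, (a k + b k) / (c k + 1) ≤ 1 := by
  intro k hk
  obtain ⟨d, rfl⟩ : ∃ d, N = k + 1 + d := ⟨N - (k + 1), by omega⟩
  clear hk
  induction d generalizing k with
  | zero => simpa using h.2.2.2.2.le
  | succ d ih =>
    rw [h.2.2.2.1 k (by omega)]
    have h1 := image_one_sub h (k := k + 1) (by omega)
    have e : k + 1 + (d + 1) = k + 1 + 1 + d := by omega
    rw [e] at h hN
    linarith [ih (k + 1) hN h]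

lemma a_add_b_le (hN : 2 ≤ N) (h : NormLFSystem N a b c) {k : ℕ} (hk : k < N) :
    a k + b k ≤ c k + 1 := by
  have := image_one_le hN h k hk
  rwa [div_le_one (h.1 k hk)] at this

lemma b_lt_one (hN : 2 ≤ N) (h : NormLFSystem N a b c) {k : ℕ} (hk : k < N) : b k < 1 :=
  (image_one_sub h hk).trans_le (image_one_le hN h k hk)

lemma a_add_b_pos (h : NormLFSystem N a b c) {k : ℕ} (hk : k < N) : 0 < a k + b k := by
  have := (b_nonneg h k hk).trans_lt (image_one_sub h hk)
  rwa [div_pos_iff_of_pos_right (h.1 k hk)] at this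

lemma a_add_b_lt (hN : 2 ≤ N) (h : NormLFSystem N a b c) {k : ℕ} (hk : k + 1 < N) :
    a k + b k < c k + 1 := by
  have := b_lt_one hN h hk
  rwa [← h.2.2.2.1 k hk, div_lt_one (h.1 k (by omega))] at this

lemma a_add_b_last (h : NormLFSystem N a b c) (hN : 2 ≤ N) :
    a (N - 1) + b (N - 1) = c (N - 1) + 1 := by
  have := h.2.2.2.2
  rwa [div_eq_one_iff_eq (h.1 _ (by omega)).ne'] at this

lemma one_add_b_mul_pos (hN : 2 ≤ N) (h : NormLFSystem N a b c) {k : ℕ} (hk : k < N) {y : ℝ}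
    (hy : -1 ≤ y) : 0 < b k * y + 1 := by
  nlinarith [b_nonneg h k hk, b_lt_one hN h hk]

lemma denom_pos (hN : 2 ≤ N) (h : NormLFSystem N a b c) {k : ℕ} (hk : k < N) {y : ℝ}
    (hy : -1 < y) : 0 < (a k + b k) * y + (c k + 1) := by
  nlinarith [a_add_b_pos h hk, a_add_b_le hN h hk]

lemma GLF_pos (hN : 2 ≤ N) (h : NormLFSystem N a b c) {k : ℕ} (hk : k < N) {y : ℝ}
    (hy : -1 < y) : 0 < GLF a b c k y := by
  have h1 := one_add_b_mul_pos hN h hk hy.le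
  have h2 := denom_pos hN h hk hy
  have h3 := (h.2.1 k hk).1
  have h4 : 0 < y + 1 := by linarith
  unfold GLF
  positivity

lemma HLF_gt (hN : 2 ≤ N) (h : NormLFSystem N a b c) {k : ℕ} (hk : k < N) {y : ℝ}
    (hy : -1 < y) : -1 < HLF a b c k y := by
  have h1 := one_add_b_mul_pos hN h hk hy.le
  have h2 := denom_pos hN h hk hy
  rw [HLF, lt_div_iff₀ h1]
  linarith

lemma HLF_iterate_gt (hN : 2 ≤ N) (h : NormLFSystem N a b c) {k : ℕ} (hk : k < N) {y : ℝ}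
    (hy : -1 < y) (m : ℕ) : -1 < (HLF a b c k)^[m] y := by
  induction m with
  | zero => simpa
  | succ m ih => rw [Function.iterate_succ_apply']; exact HLF_gt hN h hk ih

/-- The Möbius map with pole parameter `y` that fixes `0` and `1`. -/
noncomputable def moebius (y x : ℝ) : ℝ := (1 + y) * x / (1 + y * x)

lemma moebius_zero_left (x : ℝ) : moebius 0 x = x := by simp [moebius]

lemma moebius_one {y : ℝ} (hy : -1 < y) : moebius y 1 = 1 := by
  have : (1 + y) ≠ 0 := by linarith
  simp [moebius, this]

lemma moebius_zero (y : ℝ) : moebius y 0 = 0 := by simp [moebius]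

lemma one_add_mul_pos {y x : ℝ} (hy : -1 < y) (hx : x ∈ Icc (0 : ℝ) 1) : 0 < 1 + y * x := by
  obtain ⟨h0, h1⟩ := hx
  nlinarith [mul_nonneg (by linarith : 0 ≤ y + 1) h0]

lemma moebius_comp (hN : 2 ≤ N) (h : NormLFSystem N a b c) {k : ℕ} (hk : k < N) {y x : ℝ}
    (hy : -1 < y) (hx : x ∈ Icc (0 : ℝ) 1) :
    moebius y ((a k * x + b k) / (c k * x + 1)) =
      moebius y (b k) + GLF a b c k y * moebius (HLF a b c k y) x := by
  have h1 := one_add_b_mul_pos hN h hk hy.le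
  have h2 := denom_pos hN h hk hy
  have h3 : 0 < 1 + c k * x := one_add_mul_pos (by linarith [h.1 k hk]) hx
  have h3' : c k * x + 1 ≠ 0 := by linarith
  have h4 := one_add_mul_pos (HLF_gt hN h hk hy) hx
  have e4 : 1 + HLF a b c k y * x =
      (b k * y + 1 + (a k * y + c k) * x) / (b k * y + 1) := by
    rw [HLF, eq_div_iff h1.ne', add_mul, mul_right_comm, div_mul_cancel₀ _ h1.ne', one_mul]
  have h5 : b k * y + 1 + (a k * y + c k) * x ≠ 0 := by
    intro h0
    rw [e4, h0] at h4
    simp at h4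
  have e5 : 1 + y * ((a k * x + b k) / (c k * x + 1)) =
      (b k * y + 1 + (a k * y + c k) * x) / (c k * x + 1) := by
    rw [eq_div_iff h3', add_mul, mul_assoc, div_mul_cancel₀ _ h3']; ring
  have e6 : 1 + HLF a b c k y = ((a k + b k) * y + (c k + 1)) / (b k * y + 1) := by
    rw [HLF, eq_div_iff h1.ne', add_mul, div_mul_cancel₀ _ h1.ne']; ring
  have e7 : 1 + y * b k = b k * y + 1 := by ring
  rw [moebius, moebius, moebius, e4, e5, e6, e7, GLF]
  have h2' := h2.ne'
  have h1' := h1.ne'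
  generalize hD : b k * y + 1 = D at *
  generalize hE : (a k + b k) * y + (c k + 1) = E at *
  generalize hF : D + (a k * y + c k) * x = F at *
  generalize hC : c k * x + 1 = C at *
  have : (1 + y) * (a k * x + b k) / F =
      (1 + y) * b k / D + (a k - b k * c k) * (y + 1) * x / (D * F) := by
    field_simp
    rw [← hF, ← hD]
    ring
  convert this using 1
  · field_simp
  · congr 1
    field_simp

lemma sum_GLF (hN : 2 ≤ N) (h : NormLFSystem N a b c) {y : ℝ} (hy : -1 < y) :
    ∑ k ∈ Finset.range N, GLF a b c k y = 1 := by
  have key : ∀ k < N, GLF a b c k y =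
      moebius y ((a k + b k) / (c k + 1)) - moebius y (b k) := by
    intro k hk
    have := moebius_comp hN h hk hy (x := 1) (by simp)
    rw [moebius_one (HLF_gt hN h hk hy)] at this
    simp only [mul_one] at this
    linarith
  have part : ∀ n, n + 1 ≤ N → ∑ k ∈ Finset.range (n + 1), GLF a b c k y =
      moebius y ((a n + b n) / (c n + 1)) := by
    intro n
    induction n with
    | zero =>
      intro hn
      rw [Finset.sum_range_one, key 0 hn, h.2.2.1, moebius_zero, sub_zero]
    | succ n ih =>
      intro hn
      rw [Finset.sum_range_succ, ih (by omega), key (n + 1) hn, h.2.2.2.1 n hn]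
      ring
  obtain ⟨n, rfl⟩ : ∃ n, N = n + 1 := ⟨N - 1, by omega⟩
  have hl := h.2.2.2.2
  simp only [Nat.add_sub_cancel] at hl
  rw [part n le_rfl, hl, moebius_one hy]

/-! ### Limits of the weights and of the iterates -/

lemma continuousAt_GLF (hN : 2 ≤ N) (h : NormLFSystem N a b c) {k : ℕ} (hk : k < N) {y : ℝ}
    (hy : -1 < y) : ContinuousAt (GLF a b c k) y := by
  have h1 := one_add_b_mul_pos hN h hk hy.le
  have h2 := denom_pos hN h hk hy
  unfold GLF
  exact ContinuousAt.div (by fun_prop) (by fun_prop) (by positivity)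

lemma GLF_last (h : NormLFSystem N a b c) (hN : 2 ≤ N) {y : ℝ} (hy : -1 < y) :
    GLF a b c (N - 1) y = (1 - b (N - 1)) / (b (N - 1) * y + 1) := by
  have e := a_add_b_last h hN
  have hk : N - 1 < N := by omega
  have h1 := (one_add_b_mul_pos hN h hk hy.le).ne'
  have h2 := (denom_pos hN h hk hy).ne'
  have h3 := (h.1 _ hk).ne'
  have ea : a (N - 1) = c (N - 1) + 1 - b (N - 1) := by linarith
  rw [GLF, div_eq_div_iff (mul_ne_zero h1 h2) h1, ea]
  ring

lemma tendsto_GLF_neg_one (hN : 2 ≤ N) (h : NormLFSystem N a b c) {k : ℕ} (hk : k < N) :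
    Tendsto (GLF a b c k) (𝓝[>] (-1)) (𝓝 (if k = N - 1 then 1 else 0)) := by
  split_ifs with hkN
  · have hb := b_lt_one hN h hk
    have hc : ContinuousAt (fun y => (1 - b k) / (b k * y + 1)) (-1) :=
      ContinuousAt.div (by fun_prop) (by fun_prop) (by linarith)
    have e : (1 - b k) / (b k * (-1) + 1) = 1 := by
      rw [div_eq_one_iff_eq (by linarith)]; ring
    have ht := hc.tendsto.mono_left (nhdsWithin_le_nhds (s := Ioi (-1)))
    rw [e] at ht
    refine ht.congr' ?_
    filter_upwards [self_mem_nhdsWithin] with y hy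
    rw [hkN, GLF_last h hN hy]
  · have hb := b_lt_one hN h hk
    have hlt := a_add_b_lt hN h (k := k) (by omega)
    have hc : ContinuousAt (GLF a b c k) (-1) := by
      unfold GLF
      exact ContinuousAt.div (by fun_prop) (by fun_prop)
        (mul_ne_zero (by linarith) (by linarith))
    have ht := hc.tendsto.mono_left (nhdsWithin_le_nhds (s := Ioi (-1)))
    have e : GLF a b c k (-1) = 0 := by simp [GLF]
    rwa [e] at ht

lemma tendsto_GLF_atTop (hN : 2 ≤ N) (h : NormLFSystem N a b c) {k : ℕ} (hk : k < N) :
    Tendsto (GLF a b c k) atTop (𝓝 (if k = 0 then 1 else 0)) := by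
  have hs := a_add_b_pos h hk
  have hquot : Tendsto (fun y : ℝ => (y + 1) / ((a k + b k) * y + (c k + 1))) atTop
      (𝓝 (1 / (a k + b k))) := by
    have hinv : Tendsto (fun y : ℝ => y⁻¹) atTop (𝓝 0) := tendsto_inv_atTop_zero
    have : Tendsto (fun y : ℝ => (1 + y⁻¹) / ((a k + b k) + (c k + 1) * y⁻¹)) atTop
        (𝓝 ((1 + 0) / ((a k + b k) + (c k + 1) * 0))) :=
      (hinv.const_add 1).div ((hinv.const_mul _).const_add _) (by simpa using hs.ne')
    rw [mul_zero, add_zero, add_zero] at this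
    refine this.congr' ?_
    filter_upwards [eventually_gt_atTop 0] with y hy
    have h2 := (denom_pos hN h hk (by linarith : -1 < y)).ne'
    have e1 : 1 + y⁻¹ = (y + 1) / y := by field_simp
    have e2 : (a k + b k) + (c k + 1) * y⁻¹ = ((a k + b k) * y + (c k + 1)) / y := by
      field_simp
    rw [e1, e2, div_div_div_cancel_right₀ hy.ne']
  have hG : ∀ y, GLF a b c k y = (a k - b k * c k) / (b k * y + 1) *
      ((y + 1) / ((a k + b k) * y + (c k + 1))) := by
    intro y; rw [GLF, div_mul_div_comm]
  have hlim : Tendsto (fun y : ℝ => (a k - b k * c k) / (b k * y + 1)) atTop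
      (𝓝 (if k = 0 then a 0 else 0)) := by
    split_ifs with h0
    · subst h0
      simp [h.2.2.1]
    · refine Tendsto.const_div_atTop ?_ _
      exact tendsto_atTop_add_const_right _ _ (tendsto_id.const_mul_atTop (b_pos h hk h0))
  have := hlim.mul hquot
  refine (this.congr fun y => (hG y).symm).trans ?_
  split_ifs with h0
  · subst h0
    have hb := h.2.2.1
    rw [hb, add_zero] at hs ⊢
    rw [mul_one_div_cancel hs.ne']
  · simp

lemma tendsto_iterate_of_attracting {H : ℝ → ℝ} {p y : ℝ} (hp : -1 ≤ p) (hy : -1 < y)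
    (hc : ContinuousOn H (Ici (-1)))
    (hbelow : ∀ x, -1 < x → x ≤ p → x ≤ H x ∧ H x ≤ p)
    (hgt : ∀ x, -1 < x → -1 < H x)
    (habove : ∀ x, -1 < x → p ≤ x → p ≤ H x ∧ H x ≤ x)
    (hfix : ∀ x, -1 < x → H x = x → x = p) :
    Tendsto (fun m => H^[m] y) atTop (𝓝 p) := by
  have limfix : ∀ l, -1 ≤ l → (∀ m, -1 < H^[m] y) → Tendsto (fun m => H^[m] y) atTop (𝓝 l) →
      H l = l := by
    intro l hl hgt ht
    have h1 : Tendsto (fun m => H (H^[m] y)) atTop (𝓝 (H l)) := by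
      refine (hc l hl).tendsto.comp (tendsto_nhdsWithin_iff.2 ⟨ht, ?_⟩)
      exact Eventually.of_forall fun m => (hgt m).le
    have h2 : Tendsto (fun m => H^[m + 1] y) atTop (𝓝 l) := ht.comp (tendsto_add_atTop_nat 1)
    simp only [Function.iterate_succ_apply'] at h2
    exact tendsto_nhds_unique h1 h2
  rcases le_total y p with hyp | hyp
  · have hb : ∀ m, -1 < H^[m] y ∧ H^[m] y ≤ p := by
      intro m
      induction m with
      | zero => exact ⟨hy, hyp⟩
      | succ m ih =>
        rw [Function.iterate_succ_apply']
        have := hbelow _ ih.1 ih.2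
        exact ⟨ih.1.trans_le this.1, this.2⟩
    have hm : Monotone fun m => H^[m] y := by
      refine monotone_nat_of_le_succ fun m => ?_
      rw [Function.iterate_succ_apply']
      exact (hbelow _ (hb m).1 (hb m).2).1
    have ht := tendsto_atTop_ciSup hm ⟨p, by rintro _ ⟨m, rfl⟩; exact (hb m).2⟩
    have hl : y ≤ ⨆ m, H^[m] y := hm.ge_of_tendsto ht 0
    have := hfix _ (hy.trans_le hl) (limfix _ (hy.le.trans hl) (fun m => (hb m).1) ht)
    rwa [this] at ht
  · have hb : ∀ m, -1 < H^[m] y ∧ p ≤ H^[m] y := by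
      intro m
      induction m with
      | zero => exact ⟨hy, hyp⟩
      | succ m ih =>
        rw [Function.iterate_succ_apply']
        exact ⟨hgt _ ih.1, (habove _ ih.1 ih.2).1⟩
    have hm : Antitone fun m => H^[m] y := by
      refine antitone_nat_of_succ_le fun m => ?_
      rw [Function.iterate_succ_apply']
      exact (habove _ (hb m).1 (hb m).2).2
    have ht := tendsto_atTop_ciInf hm ⟨p, by rintro _ ⟨m, rfl⟩; exact (hb m).2⟩
    have hl : p ≤ ⨅ m, H^[m] y := le_ciInf fun m => (hb m).2
    rcases (hp.trans hl).lt_or_eq with h | h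
    · have := hfix _ h (limfix _ h.le (fun m => (hb m).1) ht)
      rwa [this] at ht
    · have : ⨅ m, H^[m] y = p := le_antisymm (h ▸ hp) hl
      rwa [this] at ht

lemma HLF_sub_self (hN : 2 ≤ N) (h : NormLFSystem N a b c) {k : ℕ} (hk : k < N) {y : ℝ}
    (hy : -1 ≤ y) :
    HLF a b c k y - y = -(b k * y ^ 2 + (1 - a k) * y - c k) / (b k * y + 1) := by
  have h1 := (one_add_b_mul_pos hN h hk hy).ne'
  rw [HLF, div_sub' h1]
  congr 1
  ring

lemma HLF_mono (hN : 2 ≤ N) (h : NormLFSystem N a b c) {k : ℕ} (hk : k < N) {x y : ℝ}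
    (hx : -1 ≤ x) (hxy : x ≤ y) : HLF a b c k x ≤ HLF a b c k y := by
  rw [HLF, HLF, div_le_div_iff₀ (one_add_b_mul_pos hN h hk hx)
    (one_add_b_mul_pos hN h hk (hx.trans hxy))]
  nlinarith [mul_nonneg (h.2.1 k hk).1.le (sub_nonneg.2 hxy)]

lemma HLF_iterate_mono (hN : 2 ≤ N) (h : NormLFSystem N a b c) {k : ℕ} (hk : k < N) {x y : ℝ}
    (hx : -1 < x) (hxy : x ≤ y) (m : ℕ) :
    (HLF a b c k)^[m] x ≤ (HLF a b c k)^[m] y := by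
  induction m with
  | zero => simpa
  | succ m ih =>
    rw [Function.iterate_succ_apply', Function.iterate_succ_apply']
    exact HLF_mono hN h hk (HLF_iterate_gt hN h hk hx m).le ih

lemma tendsto_HLF_iterate (hN : 2 ≤ N) (h : NormLFSystem N a b c) {k : ℕ} (hk : k < N)
    {p y : ℝ} (hp : -1 ≤ p) (hy : -1 < y)
    (hroot : HLF a b c k p = p)
    (hbelow : ∀ x, -1 < x → x < p → b k * x ^ 2 + (1 - a k) * x - c k < 0)
    (habove : ∀ x, -1 < x → p < x → 0 < b k * x ^ 2 + (1 - a k) * x - c k) :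
    Tendsto (fun m => (HLF a b c k)^[m] y) atTop (𝓝 p) := by
  have hlt : ∀ x, -1 < x → x < p → x < HLF a b c k x := by
    intro x hx hxp
    have := div_pos (neg_pos.2 (hbelow x hx hxp)) (one_add_b_mul_pos hN h hk hx.le)
    rw [← HLF_sub_self hN h hk hx.le] at this
    linarith
  have hgt : ∀ x, -1 < x → p < x → HLF a b c k x < x := by
    intro x hx hxp
    have := div_neg_of_neg_of_pos (neg_neg_of_pos (habove x hx hxp))
      (one_add_b_mul_pos hN h hk hx.le)
    rw [← HLF_sub_self hN h hk hx.le] at this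
    linarith
  refine tendsto_iterate_of_attracting hp hy ?_ ?_ (fun x hx => HLF_gt hN h hk hx) ?_ ?_
  · intro x hx
    refine ContinuousAt.continuousWithinAt ?_
    unfold HLF
    exact ContinuousAt.div (by fun_prop) (by fun_prop) (one_add_b_mul_pos hN h hk hx).ne'
  · intro x hx hxp
    refine ⟨?_, hroot ▸ HLF_mono hN h hk hx.le hxp⟩
    rcases hxp.lt_or_eq with h' | rfl
    · exact (hlt x hx h').le
    · exact hroot.ge
  · intro x hx hxp
    refine ⟨?_, ?_⟩
    · calc p = HLF a b c k p := hroot.symm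
        _ ≤ _ := HLF_mono hN h hk hp hxp
    rcases hxp.lt_or_eq with h' | rfl
    · exact (hgt x hx h').le
    · exact hroot.le
  · intro x hx hfx
    rcases lt_trichotomy x p with h' | h' | h'
    · linarith [hlt x hx h']
    · exact h'
    · linarith [hgt x hx h']

lemma tendsto_iterate_fixPt_zero (hN : 2 ≤ N) (h : NormLFSystem N a b c) (ha : a 0 ≠ 1) :
    -1 < fixPt a b c 0 ∧
      ∀ y, -1 < y → Tendsto (fun m => (HLF a b c 0)^[m] y) atTop (𝓝 (fixPt a b c 0)) := by
  have h0 : 0 < N := by omega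
  have hb := h.2.2.1
  have ha1 : a 0 < 1 := by
    have := (h.2.1 0 h0).2.trans (min_le_left _ _)
    rw [hb, zero_mul, sub_zero] at this
    exact lt_of_le_of_ne this ha
  have ha2 : 0 < 1 - a 0 := by linarith
  have hac := a_add_b_lt hN h (k := 0) (by omega)
  rw [hb] at hac
  have e : fixPt a b c 0 = c 0 / (1 - a 0) := by simp [fixPt]
  have hgt : -1 < fixPt a b c 0 := by
    rw [e, lt_div_iff₀ ha2]; linarith
  have hm : fixPt a b c 0 * (1 - a 0) = c 0 := by rw [e, div_mul_cancel₀ _ ha2.ne']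
  refine ⟨hgt, fun y hy => tendsto_HLF_iterate hN h h0 hgt.le hy ?_ ?_ ?_⟩
  · rw [HLF, hb, zero_mul, zero_add, div_one]
    linarith
  · intro x _ hx
    rw [hb]
    nlinarith
  · intro x _ hx
    rw [hb]
    nlinarith

lemma tendsto_iterate_fixPt (hN : 2 ≤ N) (h : NormLFSystem N a b c) {k : ℕ} (hk : k < N)
    (h0 : k ≠ 0) : -1 ≤ fixPt a b c k ∧
      ∀ y, -1 < y → Tendsto (fun m => (HLF a b c k)^[m] y) atTop (𝓝 (fixPt a b c k)) := by
  have hb := b_pos h hk h0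
  have hb1 := b_lt_one hN h hk
  have hle := a_add_b_le hN h hk
  have e : fixPt a b c k =
      (a k - 1 + Real.sqrt ((1 - a k) ^ 2 + 4 * b k * c k)) / (2 * b k) := by simp [fixPt, h0]
  have hdisc : (2 * b k + a k - 1) ^ 2 ≤ (1 - a k) ^ 2 + 4 * b k * c k := by
    nlinarith
  have hs := Real.abs_le_sqrt hdisc
  have hss : Real.sqrt ((1 - a k) ^ 2 + 4 * b k * c k) ^ 2 = (1 - a k) ^ 2 + 4 * b k * c k :=
    Real.sq_sqrt ((sq_nonneg _).trans hdisc)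
  set s := Real.sqrt ((1 - a k) ^ 2 + 4 * b k * c k)
  have hs' := abs_le.1 hs
  set p := fixPt a b c k
  have hp : 2 * b k * p = a k - 1 + s := by rw [e]; field_simp
  have hfac : ∀ x, 4 * b k * (b k * x ^ 2 + (1 - a k) * x - c k) =
      (2 * b k * (x - p)) * (2 * b k * x - (a k - 1 - s)) := by
    intro x
    have : 2 * b k * (x - p) = 2 * b k * x - (a k - 1 + s) := by rw [← hp]; ring
    rw [this]
    linear_combination hss
  have hp1 : -1 ≤ p := by
    rw [e, le_div_iff₀ (by linarith)]
    linarith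
  have hpos : ∀ x, -1 < x → 0 < 2 * b k * x - (a k - 1 - s) := by
    intro x hx
    nlinarith
  refine ⟨hp1, fun y hy => tendsto_HLF_iterate hN h hk hp1 hy ?_ ?_ ?_⟩
  · have h1 := HLF_sub_self hN h hk hp1
    have h2 := hfac p
    rw [sub_self, mul_zero, zero_mul] at h2
    have h3 : b k * p ^ 2 + (1 - a k) * p - c k = 0 := by
      rcases mul_eq_zero.1 h2 with h | h
      · linarith
      · exact h
    rw [h3, neg_zero, zero_div] at h1
    linarith
  · intro x hx hxp
    have h1 := hfac x
    have h2 : (2 * b k * (x - p)) * (2 * b k * x - (a k - 1 - s)) < 0 :=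
      mul_neg_of_neg_of_pos (mul_neg_of_pos_of_neg (by linarith) (by linarith)) (hpos x hx)
    rw [← h1] at h2
    exact neg_of_mul_neg_right h2 (by linarith)
  · intro x hx hxp
    have h1 := hfac x
    have h2 : 0 < (2 * b k * (x - p)) * (2 * b k * x - (a k - 1 - s)) :=
      mul_pos (mul_pos (by linarith) (by linarith)) (hpos x hx)
    rw [← h1] at h2
    exact pos_of_mul_pos_right h2 (by linarith)

lemma tendsto_iterate_atTop (hN : 2 ≤ N) (h : NormLFSystem N a b c) (ha : a 0 = 1) (y : ℝ) :
    Tendsto (fun m => (HLF a b c 0)^[m] y) atTop atTop := by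
  have hb := h.2.2.1
  have hac := a_add_b_lt hN h (k := 0) (by omega)
  rw [hb] at hac
  have hc : 0 < c 0 := by linarith
  have e : ∀ m, (HLF a b c 0)^[m] y = (m : ℝ) * c 0 + y := by
    intro m
    induction m with
    | zero => simp
    | succ m ih =>
      rw [Function.iterate_succ_apply', ih, HLF, hb, ha]
      push_cast
      ring
  simp only [e]
  exact tendsto_atTop_add_const_right _ _
    (tendsto_natCast_atTop_atTop.atTop_mul_const hc)

lemma exists_filter_pVec (hN : 2 ≤ N) (h : NormLFSystem N a b c) {i k : ℕ} (hi : i < N)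
    (hk : k < N) : ∃ l : Filter ℝ, TendstoIxxClass Icc l l ∧
      (∀ y, -1 < y → Tendsto (fun m => (HLF a b c i)^[m] y) atTop l) ∧
      Tendsto (GLF a b c k) l (𝓝 (pVec N a b c i k)) := by
  by_cases h1 : i = 0 ∧ a 0 = 1
  · obtain ⟨rfl, ha⟩ := h1
    refine ⟨atTop, inferInstance, fun y _ => tendsto_iterate_atTop hN h ha y, ?_⟩
    simpa [pVec, ha] using tendsto_GLF_atTop hN h hk
  have hconv : -1 ≤ fixPt a b c i ∧
      ∀ y, -1 < y → Tendsto (fun m => (HLF a b c i)^[m] y) atTop (𝓝 (fixPt a b c i)) := by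
    by_cases h0 : i = 0
    · subst h0
      have := tendsto_iterate_fixPt_zero hN h (fun ha => h1 ⟨rfl, ha⟩)
      exact ⟨this.1.le, this.2⟩
    · exact tendsto_iterate_fixPt hN h hi h0
  by_cases h2 : fixPt a b c i = -1
  · refine ⟨𝓝[>] (-1), inferInstance, fun y hy => ?_, ?_⟩
    · refine tendsto_nhdsWithin_iff.2 ⟨h2 ▸ hconv.2 y hy, ?_⟩
      exact Eventually.of_forall fun m => HLF_iterate_gt hN h hi hy m
    · simpa only [pVec, if_neg h1, if_pos h2] using tendsto_GLF_neg_one hN h hk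
  · refine ⟨𝓝 (fixPt a b c i), inferInstance, hconv.2, ?_⟩
    simp only [pVec, if_neg h1, if_neg h2]
    exact continuousAt_GLF hN h hk (lt_of_le_of_ne hconv.1 (Ne.symm h2))

lemma eventually_GLF_iterate_near (hN : 2 ≤ N) (h : NormLFSystem N a b c) {i k : ℕ}
    (hi : i < N) (hk : k < N) {A B τ : ℝ} (hA : -1 < A) (hτ : 0 < τ) :
    ∃ m, ∀ y ∈ Icc A B,
      |GLF a b c k ((HLF a b c i)^[m] y) - pVec N a b c i k| < τ := by
  rcases lt_or_ge B A with hAB | hAB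
  · exact ⟨0, fun y hy => absurd (hy.1.trans hy.2) (not_le.2 hAB)⟩
  obtain ⟨l, hl, hit, hG⟩ := exists_filter_pVec hN h hi hk
  have hS : {y | |GLF a b c k y - pVec N a b c i k| < τ} ∈ l := by
    have := hG (Metric.ball_mem_nhds _ hτ)
    filter_upwards [this] with y hy
    simpa [Real.dist_eq] using hy
  have := (hit A hA).Icc (hit B (hA.trans_le hAB))
  have hev := tendsto_smallSets_iff.1 this _ hS
  obtain ⟨m, hm⟩ := hev.exists
  exact ⟨m, fun y hy => hm ⟨HLF_iterate_mono hN h hi hA hy.1 m,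
    HLF_iterate_mono hN h hi (hA.trans_le hy.1) hy.2 m⟩⟩

lemma exists_compact_range (hN : 2 ≤ N) (h : NormLFSystem N a b c) {η : ℝ} (hη : 0 < η) :
    ∃ A B : ℝ, -1 < A ∧ ∀ y, -1 < y → y ∉ Icc A B → ∃ k < N, GLF a b c k y < η := by
  have h0 : 0 < N := by omega
  have hn : N - 1 < N := by omega
  have t1 := tendsto_GLF_neg_one hN h h0
  rw [if_neg (by omega)] at t1
  have t2 := tendsto_GLF_atTop hN h hn
  rw [if_neg (by omega)] at t2
  obtain ⟨A, hA, hA'⟩ := mem_nhdsGT_iff_exists_Ioo_subset.1 (t1.eventually_lt_const hη)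
  obtain ⟨B, hB⟩ := eventually_atTop.1 (t2.eventually_lt_const hη)
  refine ⟨A, B, hA, fun y hy hyn => ?_⟩
  rcases lt_or_ge y A with h1 | h1
  · exact ⟨0, h0, hA' ⟨hy, h1⟩⟩
  · refine ⟨N - 1, hn, hB y ?_⟩
    by_contra! h2
    exact hyn ⟨h1, h2.le⟩

/-! ### Uniform decay of the Hellinger affinity -/

/-- The Hellinger affinity at level `n` between the digit distribution started at `y` and the
product weights `q`. -/
noncomputable def affinity (N : ℕ) (a b c q : ℕ → ℝ) : ℕ → ℝ → ℝ
  | 0, _ => 1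
  | n + 1, y => ∑ k ∈ Finset.range N,
      √(GLF a b c k y * q k) * affinity N a b c q n (HLF a b c k y)

lemma affinity_nonneg (q : ℕ → ℝ) (n : ℕ) (y : ℝ) : 0 ≤ affinity N a b c q n y := by
  induction n generalizing y with
  | zero => simp [affinity]
  | succ n ih => exact Finset.sum_nonneg fun k _ => mul_nonneg (Real.sqrt_nonneg _) (ih _)

/-- Scaling the weights scales the affinity. -/
lemma affinity_smul (q : ℕ → ℝ) {R : ℝ} (hR : 0 ≤ R) (n : ℕ) (y : ℝ) :
    affinity N a b c (fun k => R * q k) n y = √R ^ n * affinity N a b c q n y := by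
  induction n generalizing y with
  | zero => simp [affinity]
  | succ n ih =>
    simp only [affinity, Finset.mul_sum]
    refine Finset.sum_congr rfl fun k _ => ?_
    rw [ih, mul_left_comm (GLF a b c k y), Real.sqrt_mul hR]
    ring

/-- Submultiplicativity of the affinity. -/
lemma affinity_add_le (hN : 2 ≤ N) (h : NormLFSystem N a b c) (q : ℕ → ℝ) {n : ℕ} {C : ℝ}
    (hC : ∀ y, -1 < y → affinity N a b c q n y ≤ C) (m : ℕ) {y : ℝ} (hy : -1 < y) :
    affinity N a b c q (n + m) y ≤ affinity N a b c q m y * C := by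
  induction m generalizing y with
  | zero => simpa [affinity] using hC y hy
  | succ m ih =>
    rw [← add_assoc]
    simp only [affinity, Finset.sum_mul]
    refine Finset.sum_le_sum fun k hk => ?_
    rw [mul_assoc]
    exact mul_le_mul_of_nonneg_left (ih (HLF_gt hN h (Finset.mem_range.1 hk) hy))
      (Real.sqrt_nonneg _)

lemma affinity_mul_le (hN : 2 ≤ N) (h : NormLFSystem N a b c) (q : ℕ → ℝ) {n : ℕ} {C : ℝ}
    (hC : ∀ y, -1 < y → affinity N a b c q n y ≤ C) (j : ℕ) {y : ℝ} (hy : -1 < y) :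
    affinity N a b c q (n * j) y ≤ C ^ j := by
  induction j generalizing y with
  | zero => simp [affinity]
  | succ j ih =>
    have hC0 : 0 ≤ C := (affinity_nonneg q n y).trans (hC y hy)
    rw [mul_add_one, pow_succ]
    rw [add_comm]
    calc _ ≤ affinity N a b c q (n * j) y * C := affinity_add_le hN h q hC _ hy
      _ ≤ _ := mul_le_mul_of_nonneg_right (ih hy) hC0

/-- The affinity of two probability vectors is bounded away from `1` in terms of any of the
differences of coordinates. -/
lemma sum_sqrt_mul_le {p q : ℕ → ℝ} (hp : ∀ k < N, 0 ≤ p k) (hq : ∀ k < N, 0 ≤ q k)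
    (hp1 : ∑ k ∈ Finset.range N, p k = 1) (hq1 : ∑ k ∈ Finset.range N, q k = 1)
    {l : ℕ} (hl : l < N) :
    ∑ k ∈ Finset.range N, √(p k * q k) ≤ 1 - (p l - q l) ^ 2 / 8 := by
  have hid : ∀ k ∈ Finset.range N, (√(p k) - √(q k)) ^ 2 = p k + q k - 2 * √(p k * q k) := by
    intro k hk
    have hk := Finset.mem_range.1 hk
    rw [Real.sqrt_mul (hp k hk), sub_sq, Real.sq_sqrt (hp k hk), Real.sq_sqrt (hq k hk)]
    ring
  have hsum : ∑ k ∈ Finset.range N, (√(p k) - √(q k)) ^ 2 =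
      2 - 2 * ∑ k ∈ Finset.range N, √(p k * q k) := by
    rw [Finset.sum_congr rfl hid, Finset.sum_sub_distrib, Finset.sum_add_distrib, hp1, hq1,
      Finset.mul_sum]
    norm_num
  have hsingle : (√(p l) - √(q l)) ^ 2 ≤ ∑ k ∈ Finset.range N, (√(p k) - √(q k)) ^ 2 :=
    Finset.single_le_sum (f := fun k => (√(p k) - √(q k)) ^ 2) (fun _ _ => sq_nonneg _)
      (Finset.mem_range.2 hl)
  have hpl : p l ≤ 1 := hp1 ▸ Finset.single_le_sum (fun k hk => hp k (Finset.mem_range.1 hk))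
    (Finset.mem_range.2 hl)
  have hql : q l ≤ 1 := hq1 ▸ Finset.single_le_sum (fun k hk => hq k (Finset.mem_range.1 hk))
    (Finset.mem_range.2 hl)
  have s1 := Real.sqrt_le_one.2 hpl
  have s2 := Real.sqrt_le_one.2 hql
  have s3 := Real.sqrt_nonneg (p l)
  have s4 := Real.sqrt_nonneg (q l)
  have hfac : (p l - q l) ^ 2 = (√(p l) - √(q l)) ^ 2 * (√(p l) + √(q l)) ^ 2 := by
    rw [← mul_pow, mul_comm, ← sq_sub_sq, Real.sq_sqrt (hp l hl), Real.sq_sqrt (hq l hl)]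
  have h4 : (√(p l) + √(q l)) ^ 2 ≤ 4 := by nlinarith
  have : (p l - q l) ^ 2 ≤ (√(p l) - √(q l)) ^ 2 * 4 := by
    rw [hfac]; exact mul_le_mul_of_nonneg_left h4 (sq_nonneg _)
  linarith

section Weights

variable {q : ℕ → ℝ}

lemma affinity_succ_le (hN : 2 ≤ N) (h : NormLFSystem N a b c) {n : ℕ}
    (hn : ∀ y, -1 < y → affinity N a b c q n y ≤ 1) {y : ℝ} (hy : -1 < y) :
    affinity N a b c q (n + 1) y ≤ ∑ k ∈ Finset.range N, √(GLF a b c k y * q k) :=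
  Finset.sum_le_sum fun _ hk => mul_le_of_le_one_right (Real.sqrt_nonneg _)
    (hn _ (HLF_gt hN h (Finset.mem_range.1 hk) hy))

lemma affinity_le_one (hN : 2 ≤ N) (h : NormLFSystem N a b c) (hq : ∀ k < N, 0 ≤ q k)
    (hq1 : ∑ k ∈ Finset.range N, q k = 1) (n : ℕ) {y : ℝ} (hy : -1 < y) :
    affinity N a b c q n y ≤ 1 := by
  induction n generalizing y with
  | zero => simp [affinity]
  | succ n ih =>
    refine (affinity_succ_le hN h (fun y hy => ih hy) hy).trans ?_
    have := sum_sqrt_mul_le (fun k hk => (GLF_pos hN h hk hy).le) hq (sum_GLF hN h hy) hq1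
      (by omega : 0 < N)
    linarith [sq_nonneg (GLF a b c 0 y - q 0)]

lemma affinity_le_of_far (hN : 2 ≤ N) (h : NormLFSystem N a b c) (hq : ∀ k < N, 0 ≤ q k)
    (hq1 : ∑ k ∈ Finset.range N, q k = 1) {n : ℕ} (hn : 0 < n) {y : ℝ} (hy : -1 < y)
    {d : ℝ} (hd : 0 ≤ d) (hfar : ∃ l < N, d ≤ |GLF a b c l y - q l|) :
    affinity N a b c q n y ≤ 1 - d ^ 2 / 8 := by
  obtain ⟨l, hl, hdl⟩ := hfar
  obtain ⟨n, rfl⟩ := Nat.exists_eq_succ_of_ne_zero hn.ne'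
  refine (affinity_succ_le hN h (fun y hy => affinity_le_one hN h hq hq1 n hy) hy).trans ?_
  refine (sum_sqrt_mul_le (fun k hk => (GLF_pos hN h hk hy).le) hq (sum_GLF hN h hy) hq1
    hl).trans ?_
  have : d ^ 2 ≤ (GLF a b c l y - q l) ^ 2 := by
    rw [← sq_abs (GLF a b c l y - q l)]
    exact pow_le_pow_left₀ hd hdl 2
  linarith

lemma affinity_le_of_iterate_far (hN : 2 ≤ N) (h : NormLFSystem N a b c) {e : ℝ} (he : 0 < e)
    (he1 : e ≤ 1) (hq : ∀ k < N, e ≤ q k) (hq1 : ∑ k ∈ Finset.range N, q k = 1)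
    {d : ℝ} (hd : 0 ≤ d) (hde : d ≤ 3 * e / 4) {i : ℕ} (hi : i < N) (m : ℕ) {n : ℕ} (hn : m < n)
    {y : ℝ} (hy : -1 < y)
    (hfar : ∃ l < N, d ≤ |GLF a b c l ((HLF a b c i)^[m] y) - q l|) :
    affinity N a b c q n y ≤ 1 - (e / 2) ^ m * (d ^ 2 / 8) := by
  have hq0 : ∀ k < N, 0 ≤ q k := fun k hk => he.le.trans (hq k hk)
  induction m generalizing n y with
  | zero => simpa using affinity_le_of_far hN h hq0 hq1 hn hy hd (by simpa using hfar)
  | succ m ih =>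
    by_cases hfy : ∃ l < N, d ≤ |GLF a b c l y - q l|
    · refine (affinity_le_of_far hN h hq0 hq1 (by omega) hy hd hfy).trans ?_
      have : (e / 2) ^ (m + 1) ≤ 1 := pow_le_one₀ (by positivity) (by linarith)
      have := mul_le_mul_of_nonneg_right this (by positivity : 0 ≤ d ^ 2 / 8)
      linarith
    · push Not at hfy
      have hG : e / 4 ≤ GLF a b c i y := by
        have := (abs_lt.1 (hfy i hi)).1
        linarith [hq i hi]
      have hs : e / 2 ≤ √(GLF a b c i y * q i) := by
        apply Real.le_sqrt_of_sq_le
        have := mul_le_mul hG (hq i hi) he.le (by linarith)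
        linarith [this, (by ring : (e / 2) ^ 2 = e / 4 * e)]
      obtain ⟨n, rfl⟩ := Nat.exists_eq_succ_of_ne_zero (by omega : n ≠ 0)
      have ih' := ih (n := n) (by omega) (HLF_gt hN h hi hy)
        (by simpa only [Function.iterate_succ_apply] using hfar)
      set t := (e / 2) ^ m * (d ^ 2 / 8) with ht
      have ht0 : 0 ≤ t := by positivity
      have hterm : ∀ k ∈ Finset.range N,
          √(GLF a b c k y * q k) * affinity N a b c q n (HLF a b c k y) ≤
            √(GLF a b c k y * q k) - if k = i then e / 2 * t else 0 := by
        intro k hk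
        have hkN := Finset.mem_range.1 hk
        split_ifs with hki
        · subst hki
          nlinarith
        · rw [sub_zero]
          exact mul_le_of_le_one_right (Real.sqrt_nonneg _)
            (affinity_le_one hN h hq0 hq1 n (HLF_gt hN h hkN hy))
      have hsum := Finset.sum_le_sum hterm
      rw [Finset.sum_sub_distrib, Finset.sum_ite_eq' , if_pos (Finset.mem_range.2 hi)] at hsum
      have hone := sum_sqrt_mul_le (fun k hk => (GLF_pos hN h hk hy).le) hq0 (sum_GLF hN h hy)
        hq1 hi
      have e1 : (e / 2) ^ (m + 1) * (d ^ 2 / 8) = e / 2 * t := by rw [ht]; ring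
      rw [e1]
      change ∑ k ∈ Finset.range N,
        √(GLF a b c k y * q k) * affinity N a b c q n (HLF a b c k y) ≤ _
      linarith [sq_nonneg (GLF a b c i y - q i)]

end Weights

/-- If the vectors `pVec` are not all equal, then at some level the affinity is bounded away
from `1`, uniformly in the starting point and in the non-degenerate weights. -/
lemma exists_affinity_le (hN : 2 ≤ N) (h : NormLFSystem N a b c)
    (hp : ∃ i < N, ∃ j < N, ∃ k < N, pVec N a b c i k ≠ pVec N a b c j k)
    {e : ℝ} (he : 0 < e) (he1 : e ≤ 1) :
    ∃ n, 0 < n ∧ ∃ θ : ℝ, 0 < θ ∧ θ < 1 ∧ ∀ q : ℕ → ℝ, (∀ k < N, e ≤ q k) →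
      ∑ k ∈ Finset.range N, q k = 1 → ∀ y, -1 < y → affinity N a b c q n y ≤ θ := by
  obtain ⟨i, hi, j, hj, k, hk, hne⟩ := hp
  set τ := |pVec N a b c i k - pVec N a b c j k| / 4 with hτ
  have hτ0 : 0 < τ := by
    have := abs_pos.2 (sub_ne_zero.2 hne)
    positivity
  obtain ⟨A, B, hA, hAB⟩ := exists_compact_range hN h (by positivity : 0 < e / 4)
  obtain ⟨mi, hmi⟩ := eventually_GLF_iterate_near hN h hi hk (B := B) hA hτ0
  obtain ⟨mj, hmj⟩ := eventually_GLF_iterate_near hN h hj hk (B := B) hA hτ0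
  set d := min (3 * e / 4) τ with hd
  have hd0 : 0 < d := lt_min (by positivity) hτ0
  have hde : d ≤ 3 * e / 4 := min_le_left _ _
  have hdτ : d ≤ τ := min_le_right _ _
  have hpow : ∀ m ≤ mi + mj, (e / 2) ^ (mi + mj) * (d ^ 2 / 8) ≤ (e / 2) ^ m * (d ^ 2 / 8) := by
    intro m hm
    exact mul_le_mul_of_nonneg_right
      (pow_le_pow_of_le_one (by positivity) (by linarith) hm) (by positivity)
  have hpos : 0 < (e / 2) ^ (mi + mj) * (d ^ 2 / 8) := by positivity
  have hlt1 : (e / 2) ^ (mi + mj) * (d ^ 2 / 8) < 1 := by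
    have h1 := hpow 0 (by omega)
    have h2 : d ≤ 1 := by linarith
    nlinarith
  refine ⟨mi + mj + 1, by omega, 1 - (e / 2) ^ (mi + mj) * (d ^ 2 / 8), by linarith, by linarith, ?_⟩
  intro q hq hq1 y hy
  have conclude : ∀ i' < N, ∀ m ≤ mi + mj,
      (∃ l < N, d ≤ |GLF a b c l ((HLF a b c i')^[m] y) - q l|) →
      affinity N a b c q (mi + mj + 1) y ≤ 1 - (e / 2) ^ (mi + mj) * (d ^ 2 / 8) := by
    intro i' hi' m hm hfar
    have := affinity_le_of_iterate_far hN h he he1 hq hq1 hd0.le hde hi' m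
      (n := mi + mj + 1) (by omega) hy hfar
    linarith [hpow m hm]
  by_cases hyAB : y ∈ Icc A B
  · have h1 := hmi y hyAB
    have h2 := hmj y hyAB
    have h3 : 4 * τ ≤ |pVec N a b c i k - q k| + |pVec N a b c j k - q k| := by
      have e1 : 4 * τ = |pVec N a b c i k - pVec N a b c j k| := by rw [hτ]; ring
      rw [e1, abs_sub_comm (pVec N a b c j k)]
      exact abs_sub_le _ _ _
    have tri : ∀ x z w : ℝ, |x - z| < τ → 2 * τ ≤ |z - w| → d ≤ |x - w| := by
      intro x z w h1 h2
      have := abs_sub_le z x w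
      rw [abs_sub_comm z x] at this
      linarith
    rcases le_total |pVec N a b c i k - q k| |pVec N a b c j k - q k| with h4 | h4
    · exact conclude j hj mj (by omega) ⟨k, hk, tri _ _ _ h2 (by linarith)⟩
    · exact conclude i hi mi (by omega) ⟨k, hk, tri _ _ _ h1 (by linarith)⟩
  · obtain ⟨l, hl, hlt⟩ := hAB y hy hyAB
    refine conclude i hi 0 (by omega) ⟨l, hl, ?_⟩
    rw [Function.iterate_zero_apply, abs_sub_comm]
    refine le_trans ?_ (le_abs_self _)
    linarith [hq l hl]

/-! ### From the affinity to the dimension -/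

section Measure

open MeasureTheory

lemma exists_exponent {Θ κ : ℝ} (hΘ1 : Θ < 1) (hκ : 0 < κ) :
    ∃ s : ℝ, 0 < s ∧ s < 1 ∧ Θ * κ ^ (s - 1) < 1 := by
  have hc : ContinuousAt (fun s : ℝ => Θ * κ ^ (s - 1)) 1 := by
    refine ContinuousAt.mul continuousAt_const ?_
    exact ContinuousAt.rpow continuousAt_const (by fun_prop) (Or.inl hκ.ne')
  have ht := hc.tendsto
  simp only [sub_self, Real.rpow_zero, mul_one] at ht
  have hev := (ht.mono_left (nhdsWithin_le_nhds (s := Iio 1))).eventually_lt_const hΘ1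
  have hI : Ioo (0 : ℝ) 1 ∈ 𝓝[<] (1 : ℝ) := Ioo_mem_nhdsLT one_pos
  obtain ⟨s, hs, hs'⟩ := (hev.and hI).exists
  exact ⟨s, hs'.1, hs'.2, hs⟩

lemma rpow_le_of_le_mul {Θ κ ρ p s : ℝ} (hκ : 0 < κ) (hs : s < 1)
    (j : ℕ) (hρ : κ ^ j ≤ ρ) (h : ρ ≤ Θ ^ j * p) :
    ρ ^ s ≤ (Θ * κ ^ (s - 1)) ^ j * p := by
  have hκj : 0 < κ ^ j := pow_pos hκ j
  have hρ0 : 0 < ρ := hκj.trans_le hρ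
  have e1 : ρ ^ s = ρ ^ (s - 1) * ρ := by
    rw [← Real.rpow_add_one hρ0.ne']; congr 1; ring
  have e2 : (κ ^ j) ^ (s - 1) = (κ ^ (s - 1)) ^ j := by
    rw [← Real.rpow_natCast, ← Real.rpow_natCast, ← Real.rpow_mul hκ.le, ← Real.rpow_mul hκ.le,
      mul_comm]
  have h1 : ρ ^ (s - 1) ≤ (κ ^ (s - 1)) ^ j :=
    e2 ▸ Real.rpow_le_rpow_of_nonpos hκj hρ (by linarith)
  rw [e1]
  calc ρ ^ (s - 1) * ρ ≤ (κ ^ (s - 1)) ^ j * (Θ ^ j * p) :=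
        mul_le_mul h1 h hρ0.le (by positivity)
    _ = _ := by rw [mul_pow]; ring

/-- Covers by small sets whose measures and sizes have exponentially small Hellinger affinity
force the measure to have dimension less than one. -/
lemma dimHMeas_lt_one_of_affinity {α : Type*} {μ : Measure ℝ} [IsProbabilityMeasure μ]
    (hμ01 : μ (Ioc 0 1) = 1) (W : ℕ → Finset α) (U : α → Set ℝ) (p ρ : α → ℝ)
    (hU : ∀ w, MeasurableSet (U w)) {κ l Θ : ℝ} (hκ : 0 < κ) (hl0 : 0 ≤ l) (hl : l < 1)
    (hΘ : 0 < Θ) (hΘ1 : Θ < 1)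
    (hcover : ∀ j, Ioc (0 : ℝ) 1 ⊆ ⋃ w ∈ W j, U w)
    (hp : ∀ j, ∀ w ∈ W j, 0 ≤ p w) (hμ : ∀ j, ∀ w ∈ W j, μ (U w) = ENNReal.ofReal (p w))
    (hsum : ∀ j, ∑ w ∈ W j, p w = 1)
    (hdiam : ∀ j, ∀ w ∈ W j, Metric.ediam (U w) ≤ ENNReal.ofReal (ρ w))
    (hρ : ∀ j, ∀ w ∈ W j, κ ^ j ≤ ρ w ∧ ρ w ≤ l ^ j)
    (haff : ∀ j, ∑ w ∈ W j, √(p w * ρ w) ≤ Θ ^ j) :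
    dimHMeas μ < 1 := by
  classical
  obtain ⟨s, hs0, hs1, hΛ⟩ := exists_exponent hΘ1 hκ
  set Λ := Θ * κ ^ (s - 1) with hΛdef
  have hΛ0 : 0 ≤ Λ := by positivity
  have hρ0 : ∀ j, ∀ w ∈ W j, 0 < ρ w := fun j w hw => (pow_pos hκ j).trans_le (hρ j w hw).1
  set good : ℕ → Finset α := fun j => (W j).filter fun w => ρ w ≤ Θ ^ j * p w with hgood
  set bad : ℕ → Finset α := fun j => (W j).filter fun w => ¬ ρ w ≤ Θ ^ j * p w with hbad
  set E : ℕ → Set ℝ := fun j => ⋃ w ∈ good j, U w with hE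
  set B : ℕ → Set ℝ := fun j => ⋃ w ∈ bad j, U w with hB
  have hEm : ∀ j, MeasurableSet (E j) := fun j => Finset.measurableSet_biUnion _ fun w _ => hU w
  have hEB : ∀ j, Ioc (0 : ℝ) 1 ⊆ E j ∪ B j := by
    intro j x hx
    obtain ⟨w, hw, hxw⟩ := mem_iUnion₂.1 (hcover j hx)
    by_cases h : ρ w ≤ Θ ^ j * p w
    · exact Or.inl (mem_iUnion₂.2 ⟨w, Finset.mem_filter.2 ⟨hw, h⟩, hxw⟩)
    · exact Or.inr (mem_iUnion₂.2 ⟨w, Finset.mem_filter.2 ⟨hw, h⟩, hxw⟩)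
  have hBμ : ∀ j, μ (B j) ≤ ENNReal.ofReal (√Θ ^ j) := by
    intro j
    have ht : 0 < √Θ ^ j := pow_pos (Real.sqrt_pos.2 hΘ) j
    have htt : √Θ ^ j * √Θ ^ j = Θ ^ j := by rw [← mul_pow, Real.mul_self_sqrt hΘ.le]
    have hterm : ∀ w ∈ bad j, √Θ ^ j * p w ≤ √(p w * ρ w) := by
      intro w hw
      obtain ⟨hwW, hlt⟩ := Finset.mem_filter.1 hw
      push Not at hlt
      apply Real.le_sqrt_of_sq_le
      have := mul_le_mul_of_nonneg_left hlt.le (hp j w hwW)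
      calc (√Θ ^ j * p w) ^ 2 = p w * (√Θ ^ j * √Θ ^ j * p w) := by ring
        _ ≤ _ := by rw [htt]; exact this
    have hle : √Θ ^ j * ∑ w ∈ bad j, p w ≤ √Θ ^ j * √Θ ^ j := by
      rw [Finset.mul_sum, htt]
      refine (Finset.sum_le_sum hterm).trans (le_trans ?_ (haff j))
      exact Finset.sum_le_sum_of_subset_of_nonneg (Finset.filter_subset _ _)
        fun _ _ _ => Real.sqrt_nonneg _
    have hle' := le_of_mul_le_mul_left hle ht
    calc μ (B j) ≤ ∑ w ∈ bad j, μ (U w) := measure_biUnion_finset_le _ _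
      _ = ∑ w ∈ bad j, ENNReal.ofReal (p w) :=
        Finset.sum_congr rfl fun w hw => hμ j w (Finset.mem_filter.1 hw).1
      _ = ENNReal.ofReal (∑ w ∈ bad j, p w) :=
        (ENNReal.ofReal_sum_of_nonneg fun w hw => hp j w (Finset.mem_filter.1 hw).1).symm
      _ ≤ _ := ENNReal.ofReal_le_ofReal hle'
  have hBsum : ∑' j, μ (B j) ≠ ⊤ := by
    refine ne_top_of_le_ne_top ?_ (ENNReal.tsum_le_tsum hBμ)
    have hsm : Summable fun j : ℕ => √Θ ^ j :=
      summable_geometric_of_lt_one (Real.sqrt_nonneg _)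
        ((Real.sqrt_lt_sqrt hΘ.le hΘ1).trans_eq Real.sqrt_one)
    exact hsm.tsum_ofReal_ne_top
  set K : ℕ → Set ℝ := fun m => Ioc 0 1 ∩ ⋂ j ≥ m, E j with hK
  have hKm : ∀ m, MeasurableSet (K m) := fun m =>
    measurableSet_Ioc.inter (MeasurableSet.biInter (to_countable _) fun j _ => hEm j)
  set A : Set ℝ := ⋃ m, K m with hAdef
  have hAm : MeasurableSet A := MeasurableSet.iUnion hKm
  have hA01 : A ⊆ Ioc 0 1 := iUnion_subset fun m => inter_subset_left
  have hAμ : μ A = 1 := by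
    have h1 := ae_eventually_notMem hBsum
    have h2 : ∀ᵐ x ∂μ, x ∈ Ioc (0 : ℝ) 1 := (prob_compl_eq_zero_iff measurableSet_Ioc).2 hμ01
    have h3 : ∀ᵐ x ∂μ, x ∈ A := by
      filter_upwards [h1, h2] with x hx1 hx2
      obtain ⟨m, hm⟩ := eventually_atTop.1 hx1
      refine mem_iUnion.2 ⟨m, hx2, mem_iInter₂.2 fun j hj => ?_⟩
      exact (hEB j hx2).resolve_right (hm j hj)
    exact (prob_compl_eq_zero_iff hAm).1 h3
  have hdimK : ∀ m, dimH (K m) ≤ ENNReal.ofReal s := by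
    intro m
    have hH : Measure.hausdorffMeasure s (K m) ≤ 0 := by
      have hr : Tendsto (fun j : ℕ => ENNReal.ofReal (l ^ j)) atTop (𝓝 0) := by
        simpa using ENNReal.tendsto_ofReal (tendsto_pow_atTop_nhds_zero_of_lt_one hl0 hl)
      have hr' : Tendsto (fun j : ℕ => ENNReal.ofReal (Λ ^ j)) atTop (𝓝 0) := by
        simpa using ENNReal.tendsto_ofReal (tendsto_pow_atTop_nhds_zero_of_lt_one hΛ0 hΛ)
      refine (Measure.hausdorffMeasure_le_liminf_sum (ι := fun j => {w // w ∈ good j}) s (K m)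
        (fun j => ENNReal.ofReal (l ^ j)) hr (fun j w => U w.1) ?_ ?_).trans ?_
      · refine Eventually.of_forall fun j w => ?_
        have hw := (Finset.mem_filter.1 w.2).1
        exact (hdiam j _ hw).trans (ENNReal.ofReal_le_ofReal (hρ j _ hw).2)
      · filter_upwards [eventually_ge_atTop m] with j hj x hx
        obtain ⟨w, hw, hxw⟩ := mem_iUnion₂.1 (mem_iInter₂.1 hx.2 j hj)
        exact mem_iUnion.2 ⟨⟨w, hw⟩, hxw⟩
      · rw [← hr'.liminf_eq]
        refine liminf_le_liminf (Eventually.of_forall fun j => ?_)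
        rw [Finset.sum_coe_sort (good j) fun w => Metric.ediam (U w) ^ s]
        calc ∑ w ∈ good j, Metric.ediam (U w) ^ s
            ≤ ∑ w ∈ good j, ENNReal.ofReal (Λ ^ j * p w) := by
              refine Finset.sum_le_sum fun w hw => ?_
              obtain ⟨hwW, hle⟩ := Finset.mem_filter.1 hw
              calc Metric.ediam (U w) ^ s ≤ ENNReal.ofReal (ρ w) ^ s :=
                    ENNReal.rpow_le_rpow (hdiam j w hwW) hs0.le
                _ = ENNReal.ofReal (ρ w ^ s) := ENNReal.ofReal_rpow_of_pos (hρ0 j w hwW)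
                _ ≤ _ := ENNReal.ofReal_le_ofReal
                  (rpow_le_of_le_mul hκ hs1 j (hρ j w hwW).1 hle)
          _ = ENNReal.ofReal (∑ w ∈ good j, Λ ^ j * p w) :=
              (ENNReal.ofReal_sum_of_nonneg fun w hw =>
                mul_nonneg (pow_nonneg hΛ0 j) (hp j w (Finset.mem_filter.1 hw).1)).symm
          _ ≤ ENNReal.ofReal (Λ ^ j) := by
              refine ENNReal.ofReal_le_ofReal ?_
              rw [← Finset.mul_sum]
              refine mul_le_of_le_one_right (pow_nonneg hΛ0 j) ?_
              rw [← hsum j]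
              exact Finset.sum_le_sum_of_subset_of_nonneg (Finset.filter_subset _ _)
                fun w hw _ => hp j w hw
    have h0 : Measure.hausdorffMeasure ((s.toNNReal : NNReal) : ℝ) (K m) ≠ ⊤ := by
      rw [Real.coe_toNNReal s hs0.le, nonpos_iff_eq_zero.1 hH]
      exact ENNReal.zero_ne_top
    exact dimH_le_of_hausdorffMeasure_ne_top h0
  have hdim : dimH A ≤ ENNReal.ofReal s := by
    rw [hAdef, dimH_iUnion]
    exact iSup_le hdimK
  have hle : dimHMeas μ ≤ dimH A :=
    sInf_le ⟨A, hAm, hA01.trans Ioc_subset_Icc_self, hAμ, rfl⟩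
  exact hle.trans_lt (hdim.trans_lt (ENNReal.ofReal_lt_one.2 hs1))

end Measure

/-! ### Words and cylinders -/

/-- The words of length `n` over the alphabet `{0, …, N - 1}`. -/
def words (N : ℕ) : ℕ → Finset (List ℕ)
  | 0 => {[]}
  | n + 1 => (Finset.range N ×ˢ words N n).map
      ⟨fun x => x.1 :: x.2, fun x y hxy => by
        obtain ⟨h1, h2⟩ := List.cons_eq_cons.1 hxy
        exact Prod.ext h1 h2⟩

lemma mem_words_succ {n : ℕ} {w : List ℕ} :
    w ∈ words N (n + 1) ↔ ∃ k < N, ∃ v ∈ words N n, w = k :: v := by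
  simp only [words, Finset.mem_map, Finset.mem_product, Finset.mem_range,
    Prod.exists]
  constructor
  · rintro ⟨k, v, ⟨hk, hv⟩, rfl⟩
    exact ⟨k, hk, v, hv, rfl⟩
  · rintro ⟨k, hk, v, hv, rfl⟩
    exact ⟨k, v, ⟨hk, hv⟩, rfl⟩

lemma sum_words_succ (n : ℕ) (F : List ℕ → ℝ) :
    ∑ w ∈ words N (n + 1), F w = ∑ k ∈ Finset.range N, ∑ v ∈ words N n, F (k :: v) := by
  rw [words, Finset.sum_map, Finset.sum_product]
  rfl

/-- The probability of a word for the digit process started at `y`. -/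
noncomputable def wordProb (a b c : ℕ → ℝ) : List ℕ → ℝ → ℝ
  | [], _ => 1
  | k :: w, y => GLF a b c k y * wordProb a b c w (HLF a b c k y)

/-- The product of the ratios along a word. -/
def wordRatio (r : ℕ → ℝ) : List ℕ → ℝ
  | [] => 1
  | k :: w => r k * wordRatio r w

/-- The composition of the maps `f k` along a word. -/
def wordMap (f : ℕ → ℝ → ℝ) : List ℕ → ℝ → ℝ
  | [], x => x
  | k :: w, x => f k (wordMap f w x)

lemma wordProb_nonneg (hN : 2 ≤ N) (h : NormLFSystem N a b c) (n : ℕ) :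
    ∀ w ∈ words N n, ∀ y, -1 < y → 0 ≤ wordProb a b c w y := by
  induction n with
  | zero => intro w hw y _; obtain rfl := Finset.mem_singleton.1 hw; simp [wordProb]
  | succ n ih =>
    intro w hw y hy
    obtain ⟨k, hk, v, hv, rfl⟩ := mem_words_succ.1 hw
    exact mul_nonneg (GLF_pos hN h hk hy).le (ih v hv _ (HLF_gt hN h hk hy))

lemma sum_wordProb (hN : 2 ≤ N) (h : NormLFSystem N a b c) (n : ℕ) {y : ℝ} (hy : -1 < y) :
    ∑ w ∈ words N n, wordProb a b c w y = 1 := by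
  induction n generalizing y with
  | zero => simp [words, wordProb]
  | succ n ih =>
    rw [sum_words_succ, ← sum_GLF hN h hy]
    refine Finset.sum_congr rfl fun k hk => ?_
    simp only [wordProb]
    rw [← Finset.mul_sum, ih (HLF_gt hN h (Finset.mem_range.1 hk) hy), mul_one]

lemma sum_sqrt_wordProb (hN : 2 ≤ N) (h : NormLFSystem N a b c) {r : ℕ → ℝ}
    (hr : ∀ k < N, 0 ≤ r k) (n : ℕ) {y : ℝ} (hy : -1 < y) :
    ∑ w ∈ words N n, √(wordProb a b c w y * wordRatio r w) = affinity N a b c r n y := by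
  induction n generalizing y with
  | zero => simp [words, wordProb, wordRatio, affinity]
  | succ n ih =>
    rw [sum_words_succ]
    refine Finset.sum_congr rfl fun k hk => ?_
    have hkN := Finset.mem_range.1 hk
    simp only [wordProb, wordRatio]
    rw [← ih (HLF_gt hN h hkN hy), Finset.mul_sum]
    refine Finset.sum_congr rfl fun v _ => ?_
    rw [← Real.sqrt_mul (mul_nonneg (GLF_pos hN h hkN hy).le (hr k hkN))]
    congr 1
    ring

lemma wordRatio_bounds {r : ℕ → ℝ} {s t : ℝ} (hs : 0 ≤ s) (hr : ∀ k < N, s ≤ r k ∧ r k ≤ t)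
    (n : ℕ) : ∀ w ∈ words N n, s ^ n ≤ wordRatio r w ∧ wordRatio r w ≤ t ^ n := by
  induction n with
  | zero => intro w hw; obtain rfl := Finset.mem_singleton.1 hw; simp [wordRatio]
  | succ n ih =>
    intro w hw
    obtain ⟨k, hk, v, hv, rfl⟩ := mem_words_succ.1 hw
    obtain ⟨h1, h2⟩ := ih v hv
    obtain ⟨h3, h4⟩ := hr k hk
    rw [pow_succ', pow_succ']
    exact ⟨mul_le_mul h3 h1 (pow_nonneg hs n) (hs.trans h3),
      mul_le_mul h4 h2 ((pow_nonneg hs n).trans h1) ((hs.trans h3).trans h4)⟩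

section Cylinders

variable {f : ℕ → ℝ → ℝ}

lemma wordMap_mem (hf : CompatibleSystem N f) (n : ℕ) :
    ∀ w ∈ words N n, ∀ x ∈ Icc (0 : ℝ) 1, wordMap f w x ∈ Icc (0 : ℝ) 1 := by
  induction n with
  | zero => intro w hw x hx; obtain rfl := Finset.mem_singleton.1 hw; exact hx
  | succ n ih =>
    intro w hw x hx
    obtain ⟨k, hk, v, hv, rfl⟩ := mem_words_succ.1 hw
    exact hf.1 k hk (ih v hv x hx)

lemma wordMap_zero_le_one (hf : CompatibleSystem N f) (n : ℕ) :
    ∀ w ∈ words N n, wordMap f w 0 ≤ wordMap f w 1 := by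
  induction n with
  | zero => intro w hw; obtain rfl := Finset.mem_singleton.1 hw; exact zero_le_one
  | succ n ih =>
    intro w hw
    obtain ⟨k, hk, v, hv, rfl⟩ := mem_words_succ.1 hw
    exact (hf.2.2.1 k hk).monotoneOn (wordMap_mem hf n v hv 0 (by simp))
      (wordMap_mem hf n v hv 1 (by simp)) (ih v hv)

lemma wordMap_sub_le {r : ℕ → ℝ} (hf : CompatibleSystem N f)
    (hr : ∀ k < N, IsLipConst (f k) (r k)) (n : ℕ) :
    ∀ w ∈ words N n, |wordMap f w 1 - wordMap f w 0| ≤ wordRatio r w := by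
  induction n with
  | zero => intro w hw; obtain rfl := Finset.mem_singleton.1 hw; simp [wordMap, wordRatio]
  | succ n ih =>
    intro w hw
    obtain ⟨k, hk, v, hv, rfl⟩ := mem_words_succ.1 hw
    have hl := (hr k hk).1
    exact (hl.2 _ (wordMap_mem hf n v hv 1 (by simp)) _ (wordMap_mem hf n v hv 0 (by simp))).trans
      (mul_le_mul_of_nonneg_left (ih v hv) hl.1)

lemma exists_preimage (hN : 2 ≤ N) (hf : CompatibleSystem N f) {x : ℝ} (hx : x ∈ Ioc (0 : ℝ) 1) :
    ∃ k < N, ∃ z ∈ Ioc (0 : ℝ) 1, f k z = x := by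
  have hex : ∃ k, k < N ∧ x ≤ f k 1 := ⟨N - 1, by omega, by rw [hf.2.2.2.2.2]; exact hx.2⟩
  classical
  obtain ⟨hk, hxk⟩ := Nat.find_spec hex
  set k := Nat.find hex with hkdef
  have h0 : f k 0 < x := by
    rcases Nat.eq_zero_or_pos k with h | h
    · rw [h, hf.2.2.2.1]; exact hx.1
    · rw [← hf.2.2.2.2.1 k h hk]
      by_contra! hc
      exact Nat.find_min hex (by omega : k - 1 < k) ⟨by omega, hc⟩
  obtain ⟨z, hz, hzx⟩ := intermediate_value_Ioc zero_le_one (hf.2.1 k hk) ⟨h0, hxk⟩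
  exact ⟨k, hk, z, hz, hzx⟩

lemma Ioc_subset_cylinders (hN : 2 ≤ N) (hf : CompatibleSystem N f) (n : ℕ) :
    Ioc (0 : ℝ) 1 ⊆ ⋃ w ∈ words N n, Ioc (wordMap f w 0) (wordMap f w 1) := by
  induction n with
  | zero => intro x hx; simpa [words, wordMap] using hx
  | succ n ih =>
    intro x hx
    obtain ⟨k, hk, z, hz, rfl⟩ := exists_preimage hN hf hx
    obtain ⟨v, hv, hzv⟩ := mem_iUnion₂.1 (ih hz)
    have hm := hf.2.2.1 k hk
    have hz' := Ioc_subset_Icc_self hz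
    exact mem_iUnion₂.2 ⟨k :: v, mem_words_succ.2 ⟨k, hk, v, hv, rfl⟩,
      hm (wordMap_mem hf n v hv 0 (by simp)) hz' hzv.1,
      hm.monotoneOn hz' (wordMap_mem hf n v hv 1 (by simp)) hzv.2⟩

lemma moebius_wordMap_sub {g : ℕ → ℝ → ℝ} {φ : ℝ → ℝ} (hN : 2 ≤ N) (h : NormLFSystem N a b c)
    (hg : ∀ i < N, ∀ x ∈ Icc (0 : ℝ) 1, g i x = (a i * x + b i) / (c i * x + 1))
    (hf : CompatibleSystem N f) (hφ : MapsTo φ (Icc 0 1) (Icc 0 1)) (hφ0 : φ 0 = 0)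
    (hφ1 : φ 1 = 1) (hconj : ∀ i < N, ∀ x ∈ Icc (0 : ℝ) 1, g i (φ x) = φ (f i x)) (n : ℕ) :
    ∀ w ∈ words N n, ∀ y, -1 < y →
      moebius y (φ (wordMap f w 1)) - moebius y (φ (wordMap f w 0)) = wordProb a b c w y := by
  induction n with
  | zero =>
    intro w hw y hy
    obtain rfl := Finset.mem_singleton.1 hw
    simp [wordMap, wordProb, hφ0, hφ1, moebius_one hy, moebius_zero]
  | succ n ih =>
    intro w hw y hy
    obtain ⟨k, hk, v, hv, rfl⟩ := mem_words_succ.1 hw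
    have key : ∀ x ∈ Icc (0 : ℝ) 1, moebius y (φ (wordMap f (k :: v) x)) =
        moebius y (b k) + GLF a b c k y * moebius (HLF a b c k y) (φ (wordMap f v x)) := by
      intro x hx
      have hx' := wordMap_mem hf n v hv x hx
      rw [wordMap, ← hconj k hk _ hx', hg k hk _ (hφ hx'), moebius_comp hN h hk hy (hφ hx')]
    rw [key 1 (by simp), key 0 (by simp), wordProb, ← ih v hv _ (HLF_gt hN h hk hy)]
    ring

lemma phi_zero {g : ℕ → ℝ → ℝ} {φ : ℝ → ℝ} (hN : 2 ≤ N) (h : NormLFSystem N a b c)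
    (hg : ∀ i < N, ∀ x ∈ Icc (0 : ℝ) 1, g i x = (a i * x + b i) / (c i * x + 1))
    (hf : CompatibleSystem N f) (hφ : MapsTo φ (Icc 0 1) (Icc 0 1))
    (hconj : ∀ i < N, ∀ x ∈ Icc (0 : ℝ) 1, g i (φ x) = φ (f i x)) : φ 0 = 0 := by
  have h0 : 0 < N := by omega
  have hx := hφ (show (0 : ℝ) ∈ Icc 0 1 by simp)
  have hb := h.2.2.1
  have hfix := hconj 0 h0 0 (by simp)
  rw [hf.2.2.2.1, hg 0 h0 _ hx, hb] at hfix
  set x := φ 0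
  have hc : 0 < 1 + c 0 * x := one_add_mul_pos (by linarith [h.1 0 h0]) hx
  rw [div_eq_iff (by linarith)] at hfix
  have hac := a_add_b_lt hN h (k := 0) (by omega)
  have ha1 := (h.2.1 0 h0).2.trans (min_le_left _ _)
  rw [hb] at hac ha1
  by_contra hne
  have hx0 : 0 < x := lt_of_le_of_ne hx.1 (Ne.symm hne)
  have e : a 0 = c 0 * x + 1 := by
    apply mul_right_cancel₀ hne
    linarith
  rcases le_total 0 (c 0) with h1 | h1
  · nlinarith [hx.2]
  · nlinarith [hx.2]

end Cylinders

section Measure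

open MeasureTheory

lemma measure_Ioc_of_cdf {μ : Measure ℝ} [IsProbabilityMeasure μ] {φ : ℝ → ℝ}
    (hφ : MapsTo φ (Icc 0 1) (Icc 0 1))
    (hμ : ∀ x ∈ Icc (0 : ℝ) 1, μ (Iic x) = ENNReal.ofReal (φ x)) {u v : ℝ}
    (hu : u ∈ Icc (0 : ℝ) 1) (hv : v ∈ Icc (0 : ℝ) 1) (huv : u ≤ v) :
    μ (Ioc u v) = ENNReal.ofReal (φ v - φ u) := by
  rw [← Iic_sdiff_Iic, measure_sdiff (Iic_subset_Iic.2 huv)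
    measurableSet_Iic.nullMeasurableSet (measure_ne_top _ _), hμ u hu, hμ v hv,
    ENNReal.ofReal_sub _ (hφ hu).1]

lemma phi_one {μ : Measure ℝ} [IsProbabilityMeasure μ] {φ : ℝ → ℝ}
    (hφ : MapsTo φ (Icc 0 1) (Icc 0 1)) (hμ1 : μ (Icc 0 1) = 1)
    (hμ : ∀ x ∈ Icc (0 : ℝ) 1, μ (Iic x) = ENNReal.ofReal (φ x)) : φ 1 = 1 := by
  have h1 : (1 : ENNReal) ≤ ENNReal.ofReal (φ 1) := by
    rw [← hμ 1 (by simp), ← hμ1]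
    exact measure_mono Icc_subset_Iic_self
  exact le_antisymm (hφ (by simp)).2 (ENNReal.one_le_ofReal.1 h1)

end Measure

end LFSystem

open LFSystem

open MeasureTheory in
/-- if the probability vectors `𝔭 0, …, 𝔭 (N−1)` of a normalized LF
system `{g i}` are not all equal, then for every `ε ∈ (0,1/2)` there is `δ > 0` such
that for every compatible system `{f i}` with Lipschitz constants `r i ∈ [ε, 1−ε]`
and `Σ r i < 1 + δ`, the solution `φ` of `g i ∘ φ = φ ∘ f i` satisfies
`dim_H μ_φ < 1`. -/
theorem stmt18 (N : ℕ) (hN : 2 ≤ N) (a b c : ℕ → ℝ) (g : ℕ → ℝ → ℝ)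
    (hgdef : ∀ i < N, ∀ x ∈ Set.Icc (0:ℝ) 1, g i x = (a i * x + b i) / (c i * x + 1))
    (hLF : NormLFSystem N a b c)
    (hp : ∃ i < N, ∃ j < N, ∃ k < N, pVec N a b c i k ≠ pVec N a b c j k)
    (ε : ℝ) (hε : 0 < ε) (hε' : ε < 1 / 2) :
    ∃ δ : ℝ, 0 < δ ∧
      ∀ (f : ℕ → ℝ → ℝ) (r : ℕ → ℝ),
        CompatibleSystem N f →
        (∀ i < N, IsLipConst (f i) (r i)) →
        (∀ i < N, ε ≤ r i ∧ r i ≤ 1 - ε) →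
        (∑ i ∈ Finset.range N, r i < 1 + δ) →
        ∀ (φ : ℝ → ℝ) (μ : Measure ℝ),
          Set.MapsTo φ (Set.Icc (0:ℝ) 1) (Set.Icc (0:ℝ) 1) →
          ContinuousOn φ (Set.Icc (0:ℝ) 1) →
          StrictMonoOn φ (Set.Icc (0:ℝ) 1) →
          (∀ i < N, ∀ x ∈ Set.Icc (0:ℝ) 1, g i (φ x) = φ (f i x)) →
          IsProbabilityMeasure μ →
          μ (Set.Icc (0:ℝ) 1) = 1 →
          (∀ x ∈ Set.Icc (0:ℝ) 1, μ (Set.Iic x) = ENNReal.ofReal (φ x)) →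
          dimHMeas μ < 1 := by
  obtain ⟨n, hn, θ, hθ0, hθ1, hθ⟩ :=
    exists_affinity_le hN hLF hp (e := ε / 2) (by linarith) (by linarith)
  obtain ⟨δ, hδ0, hδ1, hδ⟩ : ∃ δ : ℝ, 0 < δ ∧ δ < 1 ∧ √(1 + δ) ^ n * θ < 1 := by
    have hc : ContinuousAt (fun δ : ℝ => √(1 + δ) ^ n * θ) 0 := by fun_prop
    have ht := hc.tendsto
    simp only [add_zero, Real.sqrt_one, one_pow, one_mul] at ht
    have hev := (ht.mono_left (nhdsWithin_le_nhds (s := Ioi 0))).eventually_lt_const hθ1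
    have hI : Ioo (0 : ℝ) 1 ∈ 𝓝[>] (0 : ℝ) := Ioo_mem_nhdsGT one_pos
    obtain ⟨δ, h1, h2⟩ := (hev.and hI).exists
    exact ⟨δ, h2.1, h2.2, h1⟩
  refine ⟨δ, hδ0, ?_⟩
  intro f r hf hlip hr hsum φ μ hφ _ _ hconj hprob hμ1 hμ
  set R := ∑ k ∈ Finset.range N, r k with hR
  have hr0 : ∀ k < N, 0 ≤ r k := fun k hk => hε.le.trans (hr k hk).1
  have hR0 : 0 < R := Finset.sum_pos (fun k hk => hε.trans_le (hr k (Finset.mem_range.1 hk)).1)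
    ⟨0, Finset.mem_range.2 (by omega)⟩
  have hq : ∀ k < N, ε / 2 ≤ r k / R := fun k hk =>
    div_le_div₀ (hr0 k hk) (hr k hk).1 hR0 (by linarith)
  have hq1 : ∑ k ∈ Finset.range N, r k / R = 1 := by
    rw [← Finset.sum_div, ← hR, div_self hR0.ne']
  have hrq : r = fun k => R * (r k / R) := by
    funext k
    rw [mul_div_cancel₀ _ hR0.ne']
  have hsqrt : √R ^ n ≤ √(1 + δ) ^ n :=
    pow_le_pow_left₀ (Real.sqrt_nonneg _) (Real.sqrt_le_sqrt hsum.le) n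
  have hlevel : ∀ y, -1 < y → affinity N a b c r n y ≤ √(1 + δ) ^ n * θ := by
    intro y hy
    rw [hrq, affinity_smul _ hR0.le]
    exact mul_le_mul hsqrt (hθ _ hq hq1 y hy) (affinity_nonneg _ _ _) (by positivity)
  have hφ0 := phi_zero hN hLF hgdef hf hφ hconj
  have hφ1 := phi_one hφ hμ1 hμ
  have hΘ0 : 0 < √(1 + δ) ^ n * θ :=
    mul_pos (pow_pos (Real.sqrt_pos.2 (by linarith)) n) hθ0
  have hprobs : ∀ j, ∀ w ∈ words N (n * j), μ (Ioc (wordMap f w 0) (wordMap f w 1)) =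
      ENNReal.ofReal (wordProb a b c w 0) := by
    intro j w hw
    rw [measure_Ioc_of_cdf hφ hμ (wordMap_mem hf _ w hw 0 (by simp))
      (wordMap_mem hf _ w hw 1 (by simp)) (wordMap_zero_le_one hf _ w hw),
      ← moebius_wordMap_sub hN hLF hgdef hf hφ hφ0 hφ1 hconj _ w hw 0 (by norm_num),
      moebius_zero_left, moebius_zero_left]
  refine dimHMeas_lt_one_of_affinity (κ := ε ^ n) (l := (1 - ε) ^ n) ?_
    (fun j => words N (n * j)) (fun w => Ioc (wordMap f w 0) (wordMap f w 1))
    (fun w => wordProb a b c w 0) (wordRatio r) (fun w => measurableSet_Ioc) (pow_pos hε n)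
    (pow_nonneg (by linarith) n) (pow_lt_one₀ (by linarith) (by linarith) hn.ne') hΘ0 hδ
    (fun j => Ioc_subset_cylinders hN hf _)
    (fun j w hw => wordProb_nonneg hN hLF _ w hw 0 (by norm_num)) hprobs
    (fun j => sum_wordProb hN hLF _ (by norm_num)) ?_ ?_ ?_
  · rw [measure_Ioc_of_cdf hφ hμ (by simp) (by simp) zero_le_one, hφ0, hφ1]
    simp
  · intro j w hw
    rw [Real.ediam_Ioc]
    exact ENNReal.ofReal_le_ofReal ((le_abs_self _).trans (wordMap_sub_le hf hlip _ w hw))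
  · intro j w hw
    rw [← pow_mul, ← pow_mul]
    exact wordRatio_bounds hε.le hr _ w hw
  · intro j
    rw [sum_sqrt_wordProb hN hLF hr0 _ (by norm_num)]
    exact affinity_mul_le hN hLF r hlevel j (by norm_num)
end

section
/- Let {g_i}_{i∈𝓘_N} be a normalized LF system on [0,1] with associated probability vectors 𝔭_0,…,𝔭_{N−1}. Suppose the 𝔭_i are all equal, i.e., |{𝔭_i : i ∈ 𝓘_N}| = 1. Then for every ε ∈ (0,1/2) there exists δ > 0 with the following property: for every compatible system {f_i}_{i∈𝓘_N} on [0,1] such that each f_i is Lipschitz with r_i := Lip(f_i) satisfying ε ≤ r_i ≤ 1−ε for all i ∈ 𝓘_N, Σ_{i∈𝓘_N} r_i < 1+δ, and ‖r − 𝔭_0‖ := Σ_{i∈𝓘_N} |r_i − (𝔭_0)_i| ≥ ε, the unique continuous strictly increasing solution φ of g_i∘φ = φ∘f_i (i ∈ 𝓘_N) satisfies dim_H μ_φ < 1. -/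
open Set Filter Topology

section

open MeasureTheory

/-- The composition `f (w 0) ∘ f (w 1) ∘ ⋯ ∘ f (w (n - 1))` along a word `w`. -/
def wordMap {N : ℕ} (f : ℕ → ℝ → ℝ) : (n : ℕ) → (Fin n → Fin N) → ℝ → ℝ
  | 0, _ => id
  | n + 1, w => f (w 0) ∘ wordMap f n (Fin.tail w)

lemma wordMap_succ {N n : ℕ} (f : ℕ → ℝ → ℝ) (w : Fin (n + 1) → Fin N) (x : ℝ) :
    wordMap f (n + 1) w x = f (w 0) (wordMap f n (Fin.tail w) x) := rfl

lemma CompatibleSystem.exists_preimage {N : ℕ} {f : ℕ → ℝ → ℝ} (hN : 0 < N)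
    (hf : CompatibleSystem N f) {x : ℝ} (hx : x ∈ Ioc (0 : ℝ) 1) :
    ∃ i < N, ∃ x' ∈ Ioc (0 : ℝ) 1, f i x' = x := by
  classical
  obtain ⟨-, hcont, -, h0, hglue, h1⟩ := hf
  have hlast : x ≤ f (N - 1) 1 := hx.2.trans_eq h1.symm
  have hex : ∃ i, x ≤ f i 1 := ⟨N - 1, hlast⟩
  have hlt : Nat.find hex < N :=
    lt_of_le_of_lt (Nat.find_min' hex hlast) (by omega)
  have hle := Nat.find_spec hex
  have hgt : f (Nat.find hex) 0 < x := by
    rcases Nat.eq_zero_or_pos (Nat.find hex) with h | h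
    · rw [h, h0]; exact hx.1
    · rw [← hglue _ h hlt]
      exact not_le.1 (Nat.find_min hex (m := Nat.find hex - 1) (by omega))
  obtain ⟨x', hx', hfx⟩ := intermediate_value_Icc zero_le_one (hcont _ hlt) ⟨hgt.le, hle⟩
  refine ⟨_, hlt, x', ⟨lt_of_le_of_ne hx'.1 ?_, hx'.2⟩, hfx⟩
  rintro rfl
  exact hgt.ne hfx

lemma wordMap_mapsTo {N : ℕ} {f : ℕ → ℝ → ℝ}
    (hf : ∀ i < N, MapsTo (f i) (Icc (0 : ℝ) 1) (Icc (0 : ℝ) 1)) (n : ℕ) (w : Fin n → Fin N) :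
    MapsTo (wordMap f n w) (Icc (0 : ℝ) 1) (Icc (0 : ℝ) 1) := by
  induction n with
  | zero => exact mapsTo_id _
  | succ n ih => exact (hf _ (w 0).2).comp (ih _)

lemma wordMap_dist_le {N : ℕ} {f : ℕ → ℝ → ℝ} {r : ℕ → ℝ}
    (hf : ∀ i < N, MapsTo (f i) (Icc (0 : ℝ) 1) (Icc (0 : ℝ) 1))
    (hr : ∀ i < N, IsLipConst (f i) (r i)) (n : ℕ) (w : Fin n → Fin N) :
    |wordMap f n w 1 - wordMap f n w 0| ≤ ∏ k, r (w k) := by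
  induction n with
  | zero => simp [wordMap]
  | succ n ih =>
    rw [Fin.prod_univ_succ, wordMap_succ, wordMap_succ]
    obtain ⟨h0, hL⟩ := (hr _ (w 0).2).1
    refine (hL _ (wordMap_mapsTo hf n _ (by simp)) _ (wordMap_mapsTo hf n _ (by simp))).trans ?_
    exact mul_le_mul_of_nonneg_left (ih (Fin.tail w)) h0

lemma wordMap_affine_conj {N : ℕ} {f : ℕ → ℝ → ℝ} {p s : ℕ → ℝ} {ψ : ℝ → ℝ}
    (hf : ∀ i < N, MapsTo (f i) (Icc (0 : ℝ) 1) (Icc (0 : ℝ) 1))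
    (hψ : ∀ i < N, ∀ x ∈ Icc (0 : ℝ) 1, ψ (f i x) = p i * ψ x + s i)
    (n : ℕ) (w : Fin n → Fin N) :
    ψ (wordMap f n w 1) - ψ (wordMap f n w 0) = (∏ k, p (w k)) * (ψ 1 - ψ 0) := by
  induction n with
  | zero => simp [wordMap]
  | succ n ih =>
    have := ih (Fin.tail w)
    rw [Fin.prod_univ_succ, wordMap_succ, wordMap_succ,
      hψ _ (w 0).2 _ (wordMap_mapsTo hf n _ (by simp)),
      hψ _ (w 0).2 _ (wordMap_mapsTo hf n _ (by simp)), mul_assoc]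
    simp only [Fin.tail] at this ⊢
    rw [← this]; ring

lemma CompatibleSystem.exists_word {N : ℕ} {f : ℕ → ℝ → ℝ} (hN : 0 < N)
    (hf : CompatibleSystem N f) (n : ℕ) {x : ℝ} (hx : x ∈ Ioc (0 : ℝ) 1) :
    ∃ w : Fin n → Fin N, x ∈ Ioc (wordMap f n w 0) (wordMap f n w 1) := by
  induction n generalizing x with
  | zero => exact ⟨Fin.elim0, hx⟩
  | succ n ih =>
    obtain ⟨i, hi, x', hx', rfl⟩ := hf.exists_preimage hN hx
    obtain ⟨w, hw⟩ := ih hx'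
    refine ⟨Fin.cons ⟨i, hi⟩ w, ?_⟩
    have hmono := hf.2.2.1 i hi
    have hI := wordMap_mapsTo hf.1 n w
    simp only [wordMap_succ, Fin.cons_zero, Fin.tail_cons]
    exact ⟨hmono (hI (by simp)) (Ioc_subset_Icc_self hx') hw.1,
      hmono.monotoneOn (Ioc_subset_Icc_self hx') (hI (by simp)) hw.2⟩

lemma sum_words_prod {N : ℕ} (p : ℕ → ℝ) (n : ℕ) :
    ∑ w : Fin n → Fin N, ∏ k, p (w k) = (∑ i ∈ Finset.range N, p i) ^ n := by
  rw [Finset.sum_range, Finset.sum_pow']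
  simp

/-- A measure on `(0,1]` charging the level-`n` cylinders `(u n w, v n w]` at most `L * ∏ p (w k)`,
where these have length at most `∏ r (w k)`, has dimension below `1` as soon as the
Bhattacharyya coefficient of `p` and `r` is below `1`. -/
lemma dimHMeas_lt_one_of_cylinders {N : ℕ} {p r : ℕ → ℝ} {L ε : ℝ} (hε : 0 < ε) (hL : 0 ≤ L)
    (hp0 : ∀ i < N, 0 ≤ p i) (hp1 : ∑ i ∈ Finset.range N, p i = 1)
    (hr : ∀ i < N, ε ≤ r i ∧ r i ≤ 1 - ε)
    (hpr : ∑ i ∈ Finset.range N, √(p i * r i) < 1)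
    (u v : ∀ n, (Fin n → Fin N) → ℝ)
    (hlen : ∀ n w, v n w - u n w ≤ ∏ k, r (w k))
    (hcover : ∀ n, ∀ x ∈ Ioc (0 : ℝ) 1, ∃ w, x ∈ Ioc (u n w) (v n w))
    (μ : Measure ℝ) [IsProbabilityMeasure μ] (hμ : ∀ᵐ x ∂μ, x ∈ Ioc (0 : ℝ) 1)
    (hmass : ∀ n w, μ (Ioc (u n w) (v n w)) ≤ ENNReal.ofReal (L * ∏ k, p (w k))) :
    dimHMeas μ < 1 := by
  classical
  have hrpos : ∀ i < N, 0 < r i := fun i hi => hε.trans_le (hr i hi).1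
  obtain ⟨s, hs0, hs1, hρ⟩ : ∃ s : ℝ, 0 < s ∧ s < 1 ∧
      ∑ i ∈ Finset.range N, √(p i * r i ^ s) < 1 := by
    have hc : ContinuousAt (fun s : ℝ => ∑ i ∈ Finset.range N, √(p i * r i ^ s)) 1 := by
      refine tendsto_finsetSum _ fun i hi => ?_
      have : r i ≠ 0 := (hrpos i (Finset.mem_range.1 hi)).ne'
      exact (continuousAt_const.mul
        (Real.continuousAt_const_rpow this)).sqrt
    have h1 := hc.tendsto.eventually_lt_const (u := 1) (by simpa using hpr)
    have h2 : ∀ᶠ s : ℝ in 𝓝[<] 1, 0 < s ∧ s < 1 ∧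
        ∑ i ∈ Finset.range N, √(p i * r i ^ s) < 1 := by
      filter_upwards [h1.filter_mono nhdsWithin_le_nhds, self_mem_nhdsWithin,
        (lt_mem_nhds (zero_lt_one (α := ℝ))).filter_mono nhdsWithin_le_nhds] with s a b c
      exact ⟨c, b, a⟩
    exact h2.exists
  set ρ := ∑ i ∈ Finset.range N, √(p i * r i ^ s) with hρdef
  have hρ0 : 0 ≤ ρ := Finset.sum_nonneg fun i _ => Real.sqrt_nonneg _
  let good : ∀ n, (Fin n → Fin N) → Prop := fun n w => ∏ k, r (w k) ^ s < ∏ k, p (w k)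
  let t : ∀ n, (Fin n → Fin N) → Set ℝ := fun n w => if good n w then Ioc (u n w) (v n w) else ∅
  let D : ℕ → Set ℝ := fun n => ⋃ w, ⋃ (_ : ¬ good n w), Ioc (u n w) (v n w)
  have hpw : ∀ n (w : Fin n → Fin N), 0 ≤ ∏ k, p (w k) := fun n w =>
    Finset.prod_nonneg fun k _ => hp0 _ (w k).2
  have hrw : ∀ n (w : Fin n → Fin N), 0 ≤ ∏ k, r (w k) := fun n w =>
    Finset.prod_nonneg fun k _ => (hrpos _ (w k).2).le
  have hD : ∀ n, μ (D n) ≤ ENNReal.ofReal (L * ρ ^ n) := by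
    intro n
    calc μ (D n) ≤ ∑ w, μ (⋃ (_ : ¬ good n w), Ioc (u n w) (v n w)) :=
          measure_iUnion_fintype_le _ _
      _ ≤ ∑ w : Fin n → Fin N, ENNReal.ofReal (L * ∏ k, √(p (w k) * r (w k) ^ s)) := by
          refine Finset.sum_le_sum fun w _ => ?_
          by_cases hg : good n w
          · simp [hg]
          · simp only [hg, not_false_eq_true, iUnion_true]
            refine (hmass n w).trans (ENNReal.ofReal_le_ofReal
              (mul_le_mul_of_nonneg_left ?_ hL))
            refine (sq_le_sq₀ (hpw n w) (Finset.prod_nonneg fun _ _ => Real.sqrt_nonneg _)).1 ?_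
            rw [← Finset.prod_pow _ _ fun k => √(p (w k) * r (w k) ^ s)]
            have : ∀ k, √(p (w k) * r (w k) ^ s) ^ 2 = p (w k) * r (w k) ^ s := fun k =>
              Real.sq_sqrt (mul_nonneg (hp0 _ (w k).2) (Real.rpow_nonneg (hrpos _ (w k).2).le _))
            simp only [this, Finset.prod_mul_distrib, sq]
            exact mul_le_mul_of_nonneg_left (not_lt.1 hg) (hpw n w)
      _ = ENNReal.ofReal (L * ρ ^ n) := by
          rw [← ENNReal.ofReal_sum_of_nonneg, ← Finset.mul_sum,
            sum_words_prod fun i => √(p i * r i ^ s)]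
          exact fun w _ => mul_nonneg hL (Finset.prod_nonneg fun _ _ => Real.sqrt_nonneg _)
  have hsum : ∑' n, μ (D n) ≠ ⊤ := by
    have hsm : Summable fun n => L * ρ ^ n := (summable_geometric_of_lt_one hρ0 hρ).mul_left _
    exact ne_top_of_le_ne_top (hsm.tsum_ofReal_ne_top) (ENNReal.tsum_le_tsum hD)
  let A : Set ℝ := Ioc 0 1 ∩ ⋃ m, ⋂ n, ⋂ (_ : m ≤ n), ⋃ w, t n w
  have hAm : MeasurableSet A := by
    refine measurableSet_Ioc.inter (.iUnion fun m => .iInter fun n => .iInter fun _ =>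
      .iUnion fun w => ?_)
    simp only [t]
    split_ifs
    exacts [measurableSet_Ioc, .empty]
  have hA : ∀ᵐ x ∂μ, x ∈ A := by
    filter_upwards [hμ, ae_eventually_notMem hsum] with x hx hev
    refine ⟨hx, ?_⟩
    obtain ⟨m, hm⟩ := eventually_atTop.1 hev
    refine mem_iUnion.2 ⟨m, mem_iInter₂.2 fun n hn => ?_⟩
    obtain ⟨w, hw⟩ := hcover n x hx
    refine mem_iUnion.2 ⟨w, ?_⟩
    by_cases hg : good n w
    · simpa [t, hg] using hw
    · exact absurd (mem_iUnion₂.2 ⟨w, hg, hw⟩) (hm n hn)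
  have hdim : dimH A ≤ s.toNNReal := by
    refine (dimH_mono inter_subset_right).trans ?_
    rw [dimH_iUnion]
    refine iSup_le fun m => dimH_le_of_hausdorffMeasure_ne_top (ne_top_of_le_ne_top
      ENNReal.one_ne_top ?_)
    rw [Real.coe_toNNReal _ hs0.le]
    refine (Measure.hausdorffMeasure_le_liminf_sum (l := atTop) _ _
      (fun n => ENNReal.ofReal ((1 - ε) ^ n)) ?_ t ?_ ?_).trans ?_
    · rcases N.eq_zero_or_pos with rfl | hN
      · simp at hp1
      · have h := hr 0 hN
        simpa using ENNReal.tendsto_ofReal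
          (tendsto_pow_atTop_nhds_zero_of_lt_one (by linarith : (0 : ℝ) ≤ 1 - ε) (by linarith))
    · refine .of_forall fun n w => ?_
      simp only [t]
      split_ifs
      · rw [Real.ediam_Ioc]
        refine ENNReal.ofReal_le_ofReal ((hlen n w).trans ?_)
        refine (Finset.prod_le_prod (fun k _ => (hrpos _ (w k).2).le)
          fun k _ => (hr _ (w k).2).2).trans ?_
        simp
      · simp
    · filter_upwards [eventually_ge_atTop m] with n hn
      exact iInter₂_subset n hn
    · refine liminf_le_of_le (by isBoundedDefault) fun b hb => ?_
      obtain ⟨n, hn⟩ := hb.exists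
      refine hn.trans ?_
      calc ∑ w, Metric.ediam (t n w) ^ s ≤ ∑ w : Fin n → Fin N, ENNReal.ofReal (∏ k, p (w k)) := by
            refine Finset.sum_le_sum fun w _ => ?_
            simp only [t]
            split_ifs with hg
            · rw [Real.ediam_Ioc]
              calc ENNReal.ofReal (v n w - u n w) ^ s ≤ ENNReal.ofReal (∏ k, r (w k)) ^ s := by
                    gcongr; exact hlen n w
                _ = ENNReal.ofReal (∏ k, r (w k) ^ s) := by
                    rw [ENNReal.ofReal_rpow_of_nonneg (hrw n w) hs0.le,
                      Real.finsetProd_rpow _ _ fun k _ => (hrpos _ (w k).2).le]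
                _ ≤ _ := ENNReal.ofReal_le_ofReal hg.le
            · simp [hs0]
        _ = 1 := by
            rw [← ENNReal.ofReal_sum_of_nonneg fun w _ => hpw n w, sum_words_prod, hp1]
            simp
  refine lt_of_le_of_lt (sInf_le ⟨A, hAm, inter_subset_left.trans Ioc_subset_Icc_self,
    (prob_compl_eq_zero_iff hAm).1 hA, rfl⟩) (hdim.trans_lt ?_)
  exact_mod_cast Real.toNNReal_lt_one.2 hs1

lemma sum_sqrt_mul_lt_one {N : ℕ} {p r : ℕ → ℝ} {ε : ℝ} (hε : 0 < ε)
    (hp0 : ∀ i < N, 0 ≤ p i) (hp1 : ∑ i ∈ Finset.range N, p i = 1)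
    (hr : ∀ i < N, 0 ≤ r i ∧ r i ≤ 1)
    (hsum : ∑ i ∈ Finset.range N, r i < 1 + ε ^ 2 / (4 * N ^ 2))
    (hdist : ε ≤ ∑ i ∈ Finset.range N, |r i - p i|) :
    ∑ i ∈ Finset.range N, √(p i * r i) < 1 := by
  have hNpos : 0 < N := by
    rcases N.eq_zero_or_pos with rfl | h
    · simp at hp1
    · exact h
  have hN : (0 : ℝ) < N := by exact_mod_cast hNpos
  obtain ⟨i, hi, hgap⟩ : ∃ i ∈ Finset.range N, ε / N ≤ |r i - p i| := by
    refine Finset.exists_le_of_sum_le (Finset.nonempty_range_iff.2 hNpos.ne') ?_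
    simpa [mul_div_cancel₀ _ hN.ne'] using hdist
  have hple : ∀ i ∈ Finset.range N, p i ≤ 1 := fun i hi =>
    hp1 ▸ Finset.single_le_sum (fun j hj => hp0 j (Finset.mem_range.1 hj)) hi
  have hterm : ε ^ 2 / (4 * N ^ 2) ≤ (√(p i) - √(r i)) ^ 2 := by
    have hi' := Finset.mem_range.1 hi
    have h1 : √(p i) ≤ 1 := Real.sqrt_le_one.2 (hple i hi)
    have h2 : √(r i) ≤ 1 := Real.sqrt_le_one.2 (hr i hi').2
    have h3 := Real.sqrt_nonneg (p i)
    have h4 := Real.sqrt_nonneg (r i)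
    have h5 : |r i - p i| ≤ 2 * |√(p i) - √(r i)| := by
      have : r i - p i = -(√(p i) + √(r i)) * (√(p i) - √(r i)) := by
        nlinarith [Real.sq_sqrt (hp0 i hi'), Real.sq_sqrt (hr i hi').1]
      rw [this, abs_mul, abs_neg, abs_of_nonneg (by linarith : 0 ≤ √(p i) + √(r i))]
      exact mul_le_mul_of_nonneg_right (by linarith) (abs_nonneg _)
    have h6 : ε / (2 * N) ≤ |√(p i) - √(r i)| := by
      have : ε / (2 * N) = ε / N / 2 := by field_simp
      rw [this]; linarith
    calc ε ^ 2 / (4 * N ^ 2) = (ε / (2 * N)) ^ 2 := by field_simp; norm_num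
      _ ≤ |√(p i) - √(r i)| ^ 2 := pow_le_pow_left₀ (by positivity) h6 2
      _ = _ := sq_abs _
  have hexp : ∑ i ∈ Finset.range N, (√(p i) - √(r i)) ^ 2 =
      ∑ i ∈ Finset.range N, p i + ∑ i ∈ Finset.range N, r i
        - 2 * ∑ i ∈ Finset.range N, √(p i * r i) := by
    rw [Finset.mul_sum, ← Finset.sum_add_distrib, ← Finset.sum_sub_distrib]
    refine Finset.sum_congr rfl fun i hi => ?_
    have hi' := Finset.mem_range.1 hi
    rw [Real.sqrt_mul (hp0 i hi')]
    nlinarith [Real.sq_sqrt (hp0 i hi'), Real.sq_sqrt (hr i hi').1]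
  have hbig := Finset.single_le_sum (f := fun i => (√(p i) - √(r i)) ^ 2)
    (fun j _ => sq_nonneg _) hi
  rw [hexp, hp1] at hbig
  linarith

namespace NormLFSystem

variable {N : ℕ} {a b c : ℕ → ℝ}

lemma b_lt_right (h : NormLFSystem N a b c) {i : ℕ} (hi : i < N) :
    b i < (a i + b i) / (c i + 1) := by
  rw [lt_div_iff₀ (h.1 i hi)]
  linarith [(h.2.1 i hi).1]

lemma b_nonneg (h : NormLFSystem N a b c) {i : ℕ} (hi : i < N) : 0 ≤ b i := by
  induction i with
  | zero => exact h.2.2.1.ge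
  | succ i ih =>
    rw [← h.2.2.2.1 i hi]
    exact (ih (by omega)).trans (h.b_lt_right (by omega)).le

lemma b_pos (h : NormLFSystem N a b c) {i : ℕ} (hi : i < N) (hi0 : i ≠ 0) : 0 < b i := by
  obtain ⟨j, rfl⟩ := Nat.exists_eq_succ_of_ne_zero hi0
  rw [← h.2.2.2.1 j hi]
  exact (h.b_nonneg (by omega)).trans_lt (h.b_lt_right (by omega))

lemma right_le_one (h : NormLFSystem N a b c) {i : ℕ} (hi : i < N) :
    (a i + b i) / (c i + 1) ≤ 1 := by
  suffices H : ∀ k i, i + k + 1 = N → (a i + b i) / (c i + 1) ≤ 1 from H (N - 1 - i) i (by omega)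
  intro k
  induction k with
  | zero =>
    intro i hi
    obtain rfl : i = N - 1 := by omega
    exact h.2.2.2.2.le
  | succ k ih =>
    intro i hi
    rw [h.2.2.2.1 i (by omega)]
    exact (h.b_lt_right (by omega)).le.trans (ih (i + 1) (by omega))

lemma a_zero_lt (h : NormLFSystem N a b c) (hN : 2 ≤ N) : a 0 < c 0 + 1 := by
  have h1 := h.2.2.2.1 0 (by omega)
  have h2 := (h.b_lt_right (i := 1) (by omega)).trans_le (h.right_le_one (by omega))
  rw [zero_add] at h1
  rw [← h1, div_lt_one (h.1 0 (by omega)), h.2.2.1] at h2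
  linarith

lemma a_zero_pos (h : NormLFSystem N a b c) (hN : 2 ≤ N) : 0 < a 0 := by
  simpa [h.2.2.1] using (h.2.1 0 (by omega)).1

lemma disc_nonneg (h : NormLFSystem N a b c) {i : ℕ} (hi : i < N) :
    0 ≤ (1 - a i) ^ 2 + 4 * b i * c i := by
  have hb := h.b_nonneg hi
  have hq := h.right_le_one hi
  rw [div_le_one (h.1 i hi)] at hq
  rcases le_total 0 (c i) with hc | hc
  · positivity
  · nlinarith [sq_nonneg (2 * c i + 1 - a i)]

lemma fixPt_quadratic (h : NormLFSystem N a b c) {i : ℕ} (hi : i < N) (hi0 : i ≠ 0) :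
    b i * fixPt a b c i ^ 2 + (1 - a i) * fixPt a b c i - c i = 0 := by
  have hb := h.b_pos hi hi0
  have hs := Real.sq_sqrt (h.disc_nonneg hi)
  rw [fixPt, if_neg hi0]
  generalize √((1 - a i) ^ 2 + 4 * b i * c i) = d at hs ⊢
  field_simp
  linear_combination hs

lemma GLF_zero (h : NormLFSystem N a b c) (y : ℝ) :
    GLF a b c 0 y = a 0 * (y + 1) / (a 0 * y + (c 0 + 1)) := by
  simp [GLF, h.2.2.1]

/-- `G 0` is injective away from the junk value at its pole. -/
lemma eq_of_GLF_zero_eq (h : NormLFSystem N a b c) (hN : 2 ≤ N) {y z : ℝ}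
    (hy : 0 < y + 1) (hyz : GLF a b c 0 z = GLF a b c 0 y) : z = y := by
  have ha := h.a_zero_pos hN
  have hlt := h.a_zero_lt hN
  rw [h.GLF_zero, h.GLF_zero] at hyz
  have hyd : 0 < a 0 * y + (c 0 + 1) := by nlinarith [mul_pos ha hy]
  have hpos : 0 < a 0 * (y + 1) / (a 0 * y + (c 0 + 1)) := div_pos (mul_pos ha hy) hyd
  have hzd : a 0 * z + (c 0 + 1) ≠ 0 := by
    intro h0
    rw [h0, div_zero] at hyz
    exact hpos.ne hyz
  rw [div_eq_div_iff hzd hyd.ne'] at hyz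
  have : a 0 * (c 0 + 1 - a 0) * (z - y) = 0 := by linear_combination hyz
  rcases mul_eq_zero.1 this with h0 | h0
  · exact absurd h0 (mul_pos ha (by linarith)).ne'
  · linarith

/-- Equality of the vectors `𝔭 i` forces a common finite fixed point `y > -1` of the `H i`. -/
lemma exists_common_fixPt (h : NormLFSystem N a b c) (hN : 2 ≤ N)
    (hp : ∀ i < N, ∀ j < N, ∀ k < N, pVec N a b c i k = pVec N a b c j k) :
    ∃ y : ℝ, 0 < y + 1 ∧ (∀ i < N, b i * y ^ 2 + (1 - a i) * y - c i = 0) ∧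
      ∀ k, pVec N a b c 0 k = GLF a b c k y := by
  have ha := h.a_zero_pos hN
  have hlt := h.a_zero_lt hN
  have ha1 : a 0 ≤ 1 := by
    simpa [h.2.2.1] using (h.2.1 0 (by omega)).2.trans (min_le_left _ _)
  have hNz : (0 : ℕ) ≠ N - 1 := by omega
  have hane : a 0 ≠ 1 := by
    intro h1
    have h2 := hp 1 (by omega) 0 (by omega) 0 (by omega)
    simp only [pVec, one_ne_zero, false_and, if_false, h1, and_self, if_true] at h2
    split_ifs at h2 with h3
    · simp [hNz] at h2
    · beta_reduce at h2
      rw [h.GLF_zero] at h2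
      have hd : a 0 * fixPt a b c 1 + (c 0 + 1) ≠ 0 := by
        intro h0
        rw [h0, div_zero] at h2
        exact zero_ne_one h2
      rw [div_eq_one_iff_eq hd] at h2
      linarith
  have hpos : 0 < 1 - a 0 := sub_pos.2 (lt_of_le_of_ne ha1 hane)
  set y := c 0 / (1 - a 0) with hy
  have hfix : fixPt a b c 0 = y := by simp [fixPt, hy]
  have hy1 : 0 < y + 1 := by
    rw [hy, div_add_one hpos.ne']
    exact div_pos (by linarith) hpos
  have hp0 : ∀ k, pVec N a b c 0 k = GLF a b c k y := by
    intro k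
    simp [pVec, hane, hfix, (by linarith : y ≠ -1)]
  refine ⟨y, hy1, fun i hi => ?_, hp0⟩
  rcases eq_or_ne i 0 with rfl | hi0
  · rw [h.2.2.1, hy]
    field_simp
    ring
  · have heq := (hp i hi 0 (by omega) 0 (by omega)).trans (hp0 0)
    simp only [pVec, hi0, false_and, if_false] at heq
    split_ifs at heq with h3
    · have hd : 0 < a 0 * y + (c 0 + 1) := by nlinarith [mul_pos ha hy1]
      beta_reduce at heq
      rw [h.GLF_zero, if_neg hNz] at heq
      exact absurd heq (div_pos (mul_pos ha hy1) hd).ne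
    · rw [← h.eq_of_GLF_zero_eq hN hy1 heq]
      exact h.fixPt_quadratic hi hi0

end NormLFSystem

/-- The Möbius map of `[0,1]` fixing `0` and `1` which conjugates a normalized LF system
with common fixed point `y` to an affine system. -/
noncomputable def affinizer (y x : ℝ) : ℝ := x * (y + 1) / (x * y + 1)

lemma affinizer_den_pos {y x : ℝ} (hy : 0 < y + 1) (hx : x ∈ Icc (0 : ℝ) 1) : 0 < x * y + 1 := by
  rcases hx.2.eq_or_lt with h | h
  · simpa [h] using hy
  · nlinarith [mul_nonneg hx.1 hy.le]

lemma affinizer_sub {y u v : ℝ} (hu : 0 < u * y + 1) (hv : 0 < v * y + 1) :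
    affinizer y u - affinizer y v = (y + 1) * (u - v) / ((u * y + 1) * (v * y + 1)) := by
  rw [affinizer, affinizer, div_sub_div _ _ hu.ne' hv.ne']
  congr 1
  ring

lemma sub_le_affinizer_sub {y u v : ℝ} (hy : 0 < y + 1) (hu : u ∈ Icc (0 : ℝ) 1)
    (hv : v ∈ Icc (0 : ℝ) 1) (hvu : v ≤ u) :
    u - v ≤ (1 + |y|) ^ 2 / (y + 1) * (affinizer y u - affinizer y v) := by
  have hu' := affinizer_den_pos hy hu
  have hv' := affinizer_den_pos hy hv
  have hle : ∀ x ∈ Icc (0 : ℝ) 1, x * y + 1 ≤ 1 + |y| := fun x hx => by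
    nlinarith [le_abs_self y, abs_nonneg y, mul_le_mul_of_nonneg_left (le_abs_self y) hx.1, hx.2,
      mul_le_mul_of_nonneg_right hx.2 (abs_nonneg y)]
  rw [affinizer_sub hu' hv', div_mul_div_comm, mul_left_comm, mul_div_mul_left _ _ hy.ne',
    le_div_iff₀ (mul_pos hu' hv'), mul_comm]
  refine mul_le_mul_of_nonneg_right ?_ (sub_nonneg.2 hvu)
  rw [sq]
  exact mul_le_mul (hle u hu) (hle v hv) hv'.le (by positivity)

namespace NormLFSystem

variable {N : ℕ} {a b c : ℕ → ℝ}

lemma b_mem (h : NormLFSystem N a b c) {i : ℕ} (hi : i < N) : b i ∈ Icc (0 : ℝ) 1 :=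
  ⟨h.b_nonneg hi, (h.b_lt_right hi).le.trans (h.right_le_one hi)⟩

lemma right_mem (h : NormLFSystem N a b c) {i : ℕ} (hi : i < N) :
    (a i + b i) / (c i + 1) ∈ Icc (0 : ℝ) 1 :=
  ⟨(h.b_nonneg hi).trans (h.b_lt_right hi).le, h.right_le_one hi⟩

lemma GLF_eq_sub (h : NormLFSystem N a b c) {y : ℝ} (hy : 0 < y + 1) {i : ℕ} (hi : i < N) :
    GLF a b c i y = affinizer y ((a i + b i) / (c i + 1)) - affinizer y (b i) := by
  have hc := h.1 i hi
  have h1 := affinizer_den_pos hy (h.b_mem hi)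
  have h2 := affinizer_den_pos hy (h.right_mem hi)
  have h3 : 0 < (a i + b i) * y + (c i + 1) := by
    have := mul_pos hc h2
    field_simp at this
    linarith
  rw [affinizer_sub h2 h1, GLF]
  have h4 : (a i + b i) / (c i + 1) * y + 1 = ((a i + b i) * y + (c i + 1)) / (c i + 1) := by
    field_simp
  rw [h4]
  field_simp
  ring

lemma GLF_pos (h : NormLFSystem N a b c) {y : ℝ} (hy : 0 < y + 1) {i : ℕ} (hi : i < N) :
    0 < GLF a b c i y := by
  have h1 := affinizer_den_pos hy (h.b_mem hi)
  have h2 := affinizer_den_pos hy (h.right_mem hi)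
  rw [h.GLF_eq_sub hy hi, affinizer_sub h2 h1]
  exact div_pos (mul_pos hy (sub_pos.2 (h.b_lt_right hi))) (mul_pos h2 h1)

lemma sum_GLF (h : NormLFSystem N a b c) (hN : 2 ≤ N) {y : ℝ} (hy : 0 < y + 1) :
    ∑ i ∈ Finset.range N, GLF a b c i y = 1 := by
  have key : ∀ i ∈ Finset.range N, GLF a b c i y =
      affinizer y (if i + 1 < N then b (i + 1) else 1) - affinizer y (if i < N then b i else 1) := by
    intro i hi
    have hi := Finset.mem_range.1 hi
    rw [h.GLF_eq_sub hy hi, if_pos hi]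
    split_ifs with h1
    · rw [h.2.2.2.1 i h1]
    · obtain rfl : i = N - 1 := by omega
      rw [h.2.2.2.2]
  rw [Finset.sum_congr rfl key,
    Finset.sum_range_sub fun i => affinizer y (if i < N then b i else 1)]
  simp [affinizer, h.2.2.1, (by omega : 0 < N), hy.ne']

/-- At a common fixed point of the `H i`, the map `affinizer y` linearizes each `g i`. -/
lemma affinizer_conj (h : NormLFSystem N a b c) {y : ℝ} (hy : 0 < y + 1) {i : ℕ} (hi : i < N)
    (hq : b i * y ^ 2 + (1 - a i) * y - c i = 0) {x : ℝ} (hx : x ∈ Icc (0 : ℝ) 1) :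
    affinizer y ((a i * x + b i) / (c i * x + 1)) =
      GLF a b c i y * affinizer y x + affinizer y (b i) := by
  have hb := affinizer_den_pos hy (h.b_mem hi)
  have hxy := affinizer_den_pos hy hx
  have hc := affinizer_den_pos (h.1 i hi) hx
  have hden : (a i * x + b i) / (c i * x + 1) * y + 1 =
      (b i * y + 1) * (x * y + 1) / (c i * x + 1) := by
    rw [mul_comm x] at hc
    rw [div_mul_eq_mul_div, div_add_one hc.ne']
    congr 1
    linear_combination (-x) * hq
  have hG : GLF a b c i y = (a i - b i * c i) / (b i * y + 1) ^ 2 := by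
    have : (a i + b i) * y + (c i + 1) = (b i * y + 1) * (y + 1) := by linear_combination (-1) * hq
    rw [GLF, this]
    field_simp
  rw [mul_comm x] at hc
  have hsub := affinizer_sub (y := y) (u := (a i * x + b i) / (c i * x + 1)) (v := b i)
    (by rw [hden]; positivity) hb
  have hnum : (a i * x + b i) / (c i * x + 1) - b i = (a i - b i * c i) * x / (c i * x + 1) := by
    rw [div_sub' hc.ne']
    congr 1
    ring
  rw [← sub_eq_iff_eq_add, hsub, hden, hG, affinizer, hnum]
  generalize c i * x + 1 = e at hc
  generalize x * y + 1 = k at hxy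
  generalize b i * y + 1 = l at hb
  field_simp

end NormLFSystem

lemma measure_Ioc_of_cdf {μ : Measure ℝ} [IsFiniteMeasure μ] {φ : ℝ → ℝ}
    (hφ0 : ∀ x ∈ Icc (0 : ℝ) 1, 0 ≤ φ x)
    (hcdf : ∀ x ∈ Icc (0 : ℝ) 1, μ (Iic x) = ENNReal.ofReal (φ x)) {u v : ℝ}
    (hu : u ∈ Icc (0 : ℝ) 1) (hv : v ∈ Icc (0 : ℝ) 1) (huv : u ≤ v) :
    μ (Ioc u v) = ENNReal.ofReal (φ v - φ u) := by
  rw [← Iic_sdiff_Iic, measure_sdiff (Iic_subset_Iic.2 huv) measurableSet_Iic.nullMeasurableSet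
    (measure_ne_top _ _), hcdf u hu, hcdf v hv, ENNReal.ofReal_sub _ (hφ0 u hu)]

end

open MeasureTheory in
/-- if the probability vectors `𝔭 0, …, 𝔭 (N−1)` of a normalized LF
system `{g i}` are all equal, then for every `ε ∈ (0,1/2)` there is `δ > 0` such
that for every compatible system `{f i}` with Lipschitz constants `r i ∈ [ε, 1−ε]`,
`Σ r i < 1 + δ` and `‖r − 𝔭 0‖ = Σ_i |r i − (𝔭 0)_i| ≥ ε`, the solution `φ` of
`g i ∘ φ = φ ∘ f i` satisfies `dim_H μ_φ < 1`. -/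
theorem stmt19 (N : ℕ) (hN : 2 ≤ N) (a b c : ℕ → ℝ) (g : ℕ → ℝ → ℝ)
    (hgdef : ∀ i < N, ∀ x ∈ Set.Icc (0:ℝ) 1, g i x = (a i * x + b i) / (c i * x + 1))
    (hLF : NormLFSystem N a b c)
    (hp : ∀ i < N, ∀ j < N, ∀ k < N, pVec N a b c i k = pVec N a b c j k)
    (ε : ℝ) (hε : 0 < ε) (hε' : ε < 1 / 2) :
    ∃ δ : ℝ, 0 < δ ∧
      ∀ (f : ℕ → ℝ → ℝ) (r : ℕ → ℝ),
        CompatibleSystem N f →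
        (∀ i < N, IsLipConst (f i) (r i)) →
        (∀ i < N, ε ≤ r i ∧ r i ≤ 1 - ε) →
        (∑ i ∈ Finset.range N, r i < 1 + δ) →
        (ε ≤ ∑ i ∈ Finset.range N, |r i - pVec N a b c 0 i|) →
        ∀ (φ : ℝ → ℝ) (μ : Measure ℝ),
          Set.MapsTo φ (Set.Icc (0:ℝ) 1) (Set.Icc (0:ℝ) 1) →
          ContinuousOn φ (Set.Icc (0:ℝ) 1) →
          StrictMonoOn φ (Set.Icc (0:ℝ) 1) →
          (∀ i < N, ∀ x ∈ Set.Icc (0:ℝ) 1, g i (φ x) = φ (f i x)) →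
          IsProbabilityMeasure μ →
          μ (Set.Icc (0:ℝ) 1) = 1 →
          (∀ x ∈ Set.Icc (0:ℝ) 1, μ (Set.Iic x) = ENNReal.ofReal (φ x)) →
          dimHMeas μ < 1 := by
  obtain ⟨y, hy, hq, hp0⟩ := hLF.exists_common_fixPt hN hp
  have hNpos : 0 < N := by omega
  have hNR : (0 : ℝ) < N := by exact_mod_cast hNpos
  refine ⟨ε ^ 2 / (4 * N ^ 2), by positivity, ?_⟩
  intro f r hf hr hrε hsum hdist φ μ hφmaps hφcont hφmono hconj hμprob hμI hcdf
  simp only [hp0] at hdist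
  set p : ℕ → ℝ := fun k => GLF a b c k y with hpdef
  have hppos : ∀ i < N, 0 < p i := fun i hi => hLF.GLF_pos hy hi
  have hpsum : ∑ i ∈ Finset.range N, p i = 1 := hLF.sum_GLF hN hy
  have hψ : ∀ i < N, ∀ x ∈ Icc (0 : ℝ) 1,
      affinizer y (φ (f i x)) = p i * affinizer y (φ x) + affinizer y (b i) := by
    intro i hi x hx
    rw [← hconj i hi x hx, hgdef i hi _ (hφmaps hx)]
    exact hLF.affinizer_conj hy hi (hq i hi) (hφmaps hx)
  have h0mem : (0 : ℝ) ∈ Icc (0 : ℝ) 1 := by simp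
  have h1mem : (1 : ℝ) ∈ Icc (0 : ℝ) 1 := by simp
  have hφ0 : φ 0 = 0 := by
    have h1 := hψ 0 hNpos 0 h0mem
    have hp01 : p 0 < 1 := by
      rw [← hpsum]
      exact Finset.single_lt_sum (i := 0) (j := 1) (by simp) (by simp [hNpos])
        (Finset.mem_range.2 hN) (hppos 1 hN)
        fun k hk _ => (hppos k (Finset.mem_range.1 hk)).le
    rw [hf.2.2.2.1, hLF.2.2.1] at h1
    have h2 : (1 - p 0) * affinizer y (φ 0) = 0 := by
      have : affinizer y 0 = 0 := by simp [affinizer]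
      linear_combination h1 + this
    have h3 := (mul_eq_zero.1 h2).resolve_left (by linarith)
    have hd := affinizer_den_pos hy (hφmaps h0mem)
    rw [affinizer, div_eq_zero_iff] at h3
    simpa [hd.ne', hy.ne'] using h3
  have hφ1 : φ 1 = 1 := by
    have h1 := hcdf 1 h1mem
    have h2 : (1 : ENNReal) ≤ μ (Iic 1) := hμI ▸ measure_mono Icc_subset_Iic_self
    rw [h1, ENNReal.one_le_ofReal] at h2
    exact le_antisymm (hφmaps h1mem).2 h2
  have hμ : ∀ᵐ x ∂μ, x ∈ Ioc (0 : ℝ) 1 := by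
    refine (prob_compl_eq_zero_iff measurableSet_Ioc).2 ?_
    rw [measure_Ioc_of_cdf (fun x hx => (hφmaps hx).1) hcdf h0mem h1mem zero_le_one, hφ0, hφ1]
    simp
  have hmem := fun n (w : Fin n → Fin N) => wordMap_mapsTo hf.1 n w
  have hmono : ∀ n (w : Fin n → Fin N), wordMap f n w 0 ≤ wordMap f n w 1 := by
    intro n
    induction n with
    | zero => intro w; exact zero_le_one
    | succ n ih =>
      intro w
      exact (hf.2.2.1 _ (w 0).2).monotoneOn (hmem n _ h0mem) (hmem n _ h1mem) (ih _)
  refine dimHMeas_lt_one_of_cylinders (p := p) (r := r) (L := (1 + |y|) ^ 2 / (y + 1)) hε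
    (by positivity) (fun i hi => (hppos i hi).le) hpsum hrε
    (sum_sqrt_mul_lt_one hε (fun i hi => (hppos i hi).le) hpsum
      (fun i hi => ⟨by linarith [(hrε i hi).1], by linarith [(hrε i hi).2]⟩) hsum hdist)
    (fun n w => wordMap f n w 0) (fun n w => wordMap f n w 1)
    (fun n w => (le_abs_self _).trans (wordMap_dist_le hf.1 hr n w))
    (fun n x hx => hf.exists_word hNpos n hx) μ hμ fun n w => ?_
  rw [measure_Ioc_of_cdf (fun x hx => (hφmaps hx).1) hcdf (hmem n w h0mem) (hmem n w h1mem)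
    (hmono n w)]
  refine ENNReal.ofReal_le_ofReal ((sub_le_affinizer_sub hy (hφmaps (hmem n w h1mem))
    (hφmaps (hmem n w h0mem))
    (hφmono.monotoneOn (hmem n w h0mem) (hmem n w h1mem) (hmono n w))).trans_eq ?_)
  have hprod := wordMap_affine_conj (ψ := fun x => affinizer y (φ x)) hf.1 hψ n w
  simp only [hφ0, hφ1] at hprod
  rw [hprod]
  simp [affinizer, hy.ne']
end
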